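/- For all n ≥ 1, k ≥ 1 and 0 ≤ r ≤ n−1, the weighted Whitney numbers of Π_n^k with respect to the weight ϖ(0̂, α) = x^{μ(α)} satisfy: w_r(Π_n^k, ϖ) := Σ_{α ∈ Π_n^k, ρ(α)=r} μ̄_{Π_n^k}(0̂, α) x^{μ(α)} = (−1)^r Σ_{λ ⊢ n, ℓ(λ)=n−r} (n choose λ) (1/m(λ)!) L_{λ∖(1^{n−r})}(x_1,…,x_k), and W_r(Π_n^k, ϖ) := Σ_{α ∈ Π_n^k, ρ(α)=r} x^{μ(α)} = Σ_{λ ⊢ n, ℓ(λ)=n−r} (n choose λ) (1/m(λ)!) h_{λ∖(1^{n−r})}(x_1,…,x_k), where L_m(x_1,…,x_k) := Σ_{μ ∈ wcomp_m, supp(μ) ⊆ [k]} |Lyn_μ| x^μ and L_ν := L_{ν_1} ⋯ L_{ν_r} for a partition ν. -/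

import Mathlib

/-! Weighted partition poset Π_n^k (raw representation).
Elements of [n] are represented by `Fin n` (the element j+1 ↔ index j) and
colors 1,…,k are represented by `Fin k` (color i+1 ↔ index i). -/

abbrev WP (n k : ℕ) := Finset (Finset (Fin n) × (Fin k → ℕ))

namespace WP

variable {n k : ℕ}

/-- total weight `|μ|` of a weight vector supported in `[k]`. -/
def wsum (w : Fin k → ℕ) : ℕ := ∑ i, w i

/-- the raw finset is a genuine weighted partition of `[n]`. -/
def IsWP (π : WP n k) : Prop :=
  (∀ p ∈ π, p.1.Nonempty) ∧
  (∀ p ∈ π, ∀ q ∈ π, p ≠ q → Disjoint p.1 q.1) ∧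
  (∀ x : Fin n, ∃ p ∈ π, x ∈ p.1) ∧
  (∀ p ∈ π, wsum p.2 + 1 = p.1.card)

/-- the order relation of `Π_n^k`. -/
def le (π ρ : WP n k) : Prop :=
  IsWP π ∧ IsWP ρ ∧
  (∀ p ∈ π, ∃ q ∈ ρ, p.1 ⊆ q.1) ∧
  (∀ q ∈ ρ,
    (∀ i, (∑ p ∈ π.filter (fun p => p.1 ⊆ q.1), p.2 i) ≤ q.2 i) ∧
    (∑ i, (q.2 i - ∑ p ∈ π.filter (fun p => p.1 ⊆ q.1), p.2 i))
      = (π.filter (fun p => p.1 ⊆ q.1)).card - 1)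

def lt (π ρ : WP n k) : Prop := le π ρ ∧ π ≠ ρ

/-- the minimum element `0̂` of `Π_n^k`. -/
def bot (n k : ℕ) : WP n k := Finset.univ.image (fun x => ({x}, fun _ => 0))

/-- the maximal element `[n]^μ` of `Π_n^k`. -/
def top (n k : ℕ) (f : Fin k → ℕ) : WP n k := {(Finset.univ, f)}

-- `mobiusAux r m` iterates the defining recursion of the Möbius function of the
-- relation `r`, `m` times.  For `m` at least the length of the interval `[a,b]` this
-- computes the Möbius function `μ̄(a,b)` of the poset.
open Classical in
noncomputable def mobiusAux {Q : Type*} (r : Q → Q → Prop) : ℕ → Q → Q → ℤ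
  | 0, a, b => if a = b then 1 else 0
  | m+1, a, b => if a = b then 1 else - ∑ᶠ c ∈ {c | r a c ∧ r c b ∧ c ≠ b}, mobiusAux r m a c

/-- the Möbius function `μ̄_{Π_n^k}` (intervals of `Π_n^k` have length at most `n`). -/
noncomputable def mobius (a b : WP n k) : ℤ := mobiusAux le n a b

end WP

/-! Colored labeled binary trees.  Leaf labels are positive integers; colors are
natural numbers (the paper's color set ℙ = {1,2,…} is identified with ℕ via j ↦ j-1,
i.e. color index `i : ℕ` represents the paper's color `i+1`). -/

inductive CTree : Type
  | leaf (label : ℕ) : CTree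
  | node (color : ℕ) (l r : CTree) : CTree
deriving DecidableEq

namespace CTree

/-- leaf labels from left to right -/
def leavesList : CTree → List ℕ
  | leaf m => [m]
  | node _ l r => leavesList l ++ leavesList r

/-- the valency `v(x)`: smallest leaf label of the subtree -/
def minLeaf : CTree → ℕ
  | leaf m => m
  | node _ l r => min (minLeaf l) (minLeaf r)

/-- a tree is normalized if in every subtree the leftmost leaf carries the
smallest leaf label of the subtree. -/
def Normalized : CTree → Prop
  | leaf _ => True
  | node _ l r => Normalized l ∧ Normalized r ∧ minLeaf l < minLeaf r

/-- number of internal nodes with color `j` -/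
def colorCount : CTree → ℕ → ℕ
  | leaf _, _ => 0
  | node c l r, j => (if c = j then 1 else 0) + colorCount l j + colorCount r j

def isLeafB : CTree → Bool
  | leaf _ => true
  | node _ _ _ => false

def left : CTree → CTree
  | leaf m => leaf m
  | node _ l _ => l

def right : CTree → CTree
  | leaf m => leaf m
  | node _ _ r => r

def rootColor : CTree → ℕ
  | leaf _ => 0
  | node c _ _ => c

/-- the root of `T` is a Lyndon node: either the left child is a leaf
or `v(R(L(x))) > v(R(x))`. (Leaves count as Lyndon.) -/
def RootLyndonB (T : CTree) : Bool :=
  isLeafB T || isLeafB (left T) || decide (minLeaf (right T) < minLeaf (right (left T)))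

/-- colored Lyndon condition: every internal node that is not a Lyndon node
satisfies `color(L(x)) > color(x)` -/
def LynColored : CTree → Prop
  | leaf _ => True
  | node c l r => LynColored l ∧ LynColored r ∧
      (RootLyndonB (node c l r) = true ∨ c < rootColor l)

/-- colored comb condition: every internal node whose right child is internal
satisfies `color(x) > color(R(x))` -/
def CombColored : CTree → Prop
  | leaf _ => True
  | node c l r => CombColored l ∧ CombColored r ∧ (isLeafB r = true ∨ rootColor r < c)

/-- all colors equal to `0`: an (essentially) uncolored tree. -/
def Mono : CTree → Prop
  | leaf _ => True
  | node c l r => c = 0 ∧ Mono l ∧ Mono r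

/-- the tree has leaf label set `[n] = {1,…,n}` (each label once) -/
def OnSet (n : ℕ) (T : CTree) : Prop := T.leavesList.Perm ((List.range n).map (· + 1))

/-- `lynAux T = (b, m)`: `b` is the size of the block of `π^{Lyn}` containing the
root (`0` for a leaf) and `m` is the multiset of sizes of the other blocks. -/
def lynAux : CTree → ℕ × Multiset ℕ
  | leaf _ => (0, 0)
  | node c l r =>
    let bl := (lynAux l).1
    let ml := (lynAux l).2
    let br := (lynAux r).1
    let mr := (lynAux r).2
    let closedR := mr + (if br = 0 then 0 else {br})
    if RootLyndonB (node c l r) then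
      (1, ml + (if bl = 0 then 0 else {bl}) + closedR)
    else (1 + bl, ml + closedR)

/-- the Lyndon type `λ^{Lyn}`: multiset of block sizes of `π^{Lyn}` -/
def lynType (T : CTree) : Multiset ℕ :=
  (if (lynAux T).1 = 0 then (0 : Multiset ℕ) else {(lynAux T).1}) + (lynAux T).2

def combAux : CTree → ℕ × Multiset ℕ
  | leaf _ => (0, 0)
  | node _ l r =>
    let bl := (combAux l).1
    let ml := (combAux l).2
    let br := (combAux r).1
    let mr := (combAux r).2
    (1 + br, ml + mr + (if bl = 0 then 0 else {bl}))

/-- the comb type `λ^{Comb}`: multiset of block sizes of `π^{Comb}` -/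
def combType (T : CTree) : Multiset ℕ :=
  (if (combAux T).1 = 0 then (0 : Multiset ℕ) else {(combAux T).1}) + (combAux T).2

/-- subtrees (= nodes) of a tree -/
def subtreesC : CTree → List CTree
  | leaf m => [leaf m]
  | node c l r => node c l r :: (subtreesC l ++ subtreesC r)

end CTree

/-- normalized uncolored labeled binary trees on `[n]`: the set `Nor_n`. -/
def NorSet (n : ℕ) : Set CTree :=
  {T | T.OnSet n ∧ T.Normalized ∧ T.Mono}

/-- `Lyn_μ` for a weak composition `μ` (indexed by ℕ; `μ i` is the number of
internal nodes of color `i`). -/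
def LynSet (n : ℕ) (μ : ℕ →₀ ℕ) : Set CTree :=
  {T | T.OnSet n ∧ T.Normalized ∧ T.LynColored ∧ ∀ j, T.colorCount j = μ j}

/-- `Comb_μ` -/
def CombSet (n : ℕ) (μ : ℕ →₀ ℕ) : Set CTree :=
  {T | T.OnSet n ∧ T.Normalized ∧ T.CombColored ∧ ∀ j, T.colorCount j = μ j}

/-- `Lyn_μ` for `μ ∈ wcomp` with support in `[k]`, given as `f : Fin k → ℕ`. -/
def LynSetF (n k : ℕ) (f : Fin k → ℕ) : Set CTree :=
  {T | T.OnSet n ∧ T.Normalized ∧ T.LynColored ∧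
    ∀ j : ℕ, T.colorCount j = if h : j < k then f ⟨j, h⟩ else 0}

def CombSetF (n k : ℕ) (f : Fin k → ℕ) : Set CTree :=
  {T | T.OnSet n ∧ T.Normalized ∧ T.CombColored ∧
    ∀ j : ℕ, T.colorCount j = if h : j < k then f ⟨j, h⟩ else 0}

open MvPolynomial

/-- the complete homogeneous symmetric polynomial `h_m(x_1,…,x_k)` -/
noncomputable def hpoly (k m : ℕ) : MvPolynomial (Fin k) ℚ :=
  ∑ f ∈ Finset.Nat.antidiagonalTuple k m, ∏ i, X i ^ f i

/-- `L_m(x_1,…,x_k) = Σ_{μ ∈ wcomp_m, supp(μ) ⊆ [k]} |Lyn_μ| x^μ`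
(`= Σ_μ dim Lie(μ) x^μ`); `Lyn_μ` consists of colored Lyndon trees on `[m+1]`. -/
noncomputable def Lpoly (k m : ℕ) : MvPolynomial (Fin k) ℚ :=
  ∑ f ∈ Finset.Nat.antidiagonalTuple k m,
    (Nat.card (LynSetF (m + 1) k f) : MvPolynomial (Fin k) ℚ) * ∏ i, X i ^ f i

/-- `L_{λ∖(1^{ℓ(λ)})} = Π_i L_{λ_i - 1}` for a partition `λ` given as a multiset -/
noncomputable def LprodShift (k : ℕ) (lam : Multiset ℕ) : MvPolynomial (Fin k) ℚ :=
  (lam.map fun s => Lpoly k (s - 1)).prod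

/-- `h_{λ∖(1^{ℓ(λ)})} = Π_i h_{λ_i - 1}` -/
noncomputable def hprodShift (k : ℕ) (lam : Multiset ℕ) : MvPolynomial (Fin k) ℚ :=
  (lam.map fun s => hpoly k (s - 1)).prod

/-- the rational coefficient `(n choose λ)·(1/m(λ)!) = n!/(Π λᵢ! · Π_s m_s(λ)!)` -/
noncomputable def qcoef (n : ℕ) (lam : Multiset ℕ) : ℚ :=
  (n.factorial : ℚ) /
    (((lam.map Nat.factorial).prod : ℕ) *
      (lam.toFinset.prod fun s => (lam.count s).factorial))

/-- the set of integer partitions `λ ⊢ n` with `ℓ(λ) = n - r` parts,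
represented as multisets of positive integers -/
def ParSet (n r : ℕ) : Set (Multiset ℕ) :=
  {lam | lam.sum = n ∧ lam.card = n - r ∧ 0 ∉ lam}

/-- the weight monomial `x^{μ(α)}` of a weighted partition `α` -/
noncomputable def xmon {n k : ℕ} (α : WP n k) : MvPolynomial (Fin k) ℚ :=
  ∏ i, X i ^ (∑ p ∈ α, p.2 i)

namespace WW
open Finset

variable {n k : ℕ}

/-- weighted partitions of a subset `S` of `Fin n`. -/
def PartOn (S : Finset (Fin n)) (α : WP n k) : Prop :=
  (∀ p ∈ α, p.1.Nonempty) ∧ (∀ p ∈ α, ∀ q ∈ α, p ≠ q → Disjoint p.1 q.1) ∧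
  (∀ x, x ∈ S ↔ ∃ p ∈ α, x ∈ p.1) ∧ (∀ p ∈ α, WP.wsum p.2 + 1 = p.1.card)

lemma isWP_iff (α : WP n k) : WP.IsWP α ↔ PartOn univ α := by
  simp [WP.IsWP, PartOn]

def allWP (n k : ℕ) : Finset (WP n k) :=
  ((univ : Finset (Finset (Fin n))) ×ˢ Fintype.piFinset (fun _ : Fin k => range (n+1))).powerset

lemma PartOn.mem_all {S : Finset (Fin n)} {α : WP n k} (h : PartOn S α) : α ∈ allWP n k := by
  rw [allWP, mem_powerset]
  intro p hp
  simp only [mem_product, mem_univ, true_and, Fintype.mem_piFinset, mem_range]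
  intro i
  have h1 := h.2.2.2 p hp
  have h2 : p.1.card ≤ n := by simpa using card_le_univ p.1
  have h3 : p.2 i ≤ WP.wsum p.2 := single_le_sum (f := p.2) (fun _ _ => Nat.zero_le _) (mem_univ i)
  omega

open Classical in
noncomputable def parts (k : ℕ) (S : Finset (Fin n)) : Finset (WP n k) :=
  (allWP n k).filter (PartOn S)

lemma mem_parts {S : Finset (Fin n)} {α : WP n k} : α ∈ parts k S ↔ PartOn S α := by
  simp only [parts, mem_filter, and_iff_right_iff_imp]
  exact PartOn.mem_all

lemma PartOn.block_unique {S : Finset (Fin n)} {α : WP n k} (h : PartOn S α) {p q : Finset (Fin n) × (Fin k → ℕ)}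
    (hp : p ∈ α) (hq : q ∈ α) {x : Fin n} (hxp : x ∈ p.1) (hxq : x ∈ q.1) : p = q := by
  by_contra hne
  exact (disjoint_left.1 (h.2.1 p hp q hq hne)) hxp hxq

lemma PartOn.sub {S : Finset (Fin n)} {α : WP n k} (h : PartOn S α) {p : Finset (Fin n) × (Fin k → ℕ)}
    (hp : p ∈ α) : p.1 ⊆ S := fun x hx => (h.2.2.1 x).2 ⟨p, hp, hx⟩

lemma PartOn.union {S T : Finset (Fin n)} {α β : WP n k} (h : PartOn S α) (h' : PartOn T β)
    (hd : Disjoint S T) : PartOn (S ∪ T) (α ∪ β) := by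
  refine ⟨?_, ?_, ?_, ?_⟩
  · intro p hp
    rcases mem_union.1 hp with hp | hp
    · exact h.1 p hp
    · exact h'.1 p hp
  · intro p hp q hq hne
    rcases mem_union.1 hp with hp | hp <;> rcases mem_union.1 hq with hq | hq
    · exact h.2.1 p hp q hq hne
    · exact disjoint_of_subset_left (h.sub hp) (disjoint_of_subset_right (h'.sub hq) hd)
    · exact (disjoint_of_subset_left (h.sub hq) (disjoint_of_subset_right (h'.sub hp) hd)).symm
    · exact h'.2.1 p hp q hq hne
  · intro x
    rw [mem_union, h.2.2.1, h'.2.2.1]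
    constructor
    · rintro (⟨p, hp, hx⟩ | ⟨p, hp, hx⟩)
      · exact ⟨p, mem_union_left _ hp, hx⟩
      · exact ⟨p, mem_union_right _ hp, hx⟩
    · rintro ⟨p, hp, hx⟩
      rcases mem_union.1 hp with hp | hp
      · exact Or.inl ⟨p, hp, hx⟩
      · exact Or.inr ⟨p, hp, hx⟩
  · intro p hp
    rcases mem_union.1 hp with hp | hp
    · exact h.2.2.2 p hp
    · exact h'.2.2.2 p hp

lemma PartOn.subset {S : Finset (Fin n)} {α β : WP n k} (h : PartOn S α) (hβ : β ⊆ α) :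
    PartOn (β.biUnion Prod.fst) β :=
  ⟨fun p hp => h.1 p (hβ hp), fun p hp q hq => h.2.1 p (hβ hp) q (hβ hq),
    fun x => by simp [mem_biUnion], fun p hp => h.2.2.2 p (hβ hp)⟩

lemma partOn_singleton {p : Finset (Fin n) × (Fin k → ℕ)} (hp : WP.wsum p.2 + 1 = p.1.card) :
    PartOn p.1 ({p} : WP n k) := by
  refine ⟨?_, ?_, ?_, ?_⟩
  · intro q hq
    rw [mem_singleton] at hq; subst hq
    rw [← card_pos]; omega
  · intro q hq r hr hne
    rw [mem_singleton] at hq hr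
    exact absurd (hq.trans hr.symm) hne
  · simp
  · simpa using hp

lemma partOn_empty_iff {α : WP n k} : PartOn (∅ : Finset (Fin n)) α ↔ α = ∅ := by
  constructor
  · intro h
    rw [eq_empty_iff_forall_notMem]
    intro p hp
    obtain ⟨x, hx⟩ := h.1 p hp
    exact absurd (h.sub hp hx) (by simp)
  · rintro rfl
    simp [PartOn]

lemma PartOn.sum_wsum {S : Finset (Fin n)} {α : WP n k} (h : PartOn S α) :
    (∑ p ∈ α, WP.wsum p.2) + α.card = S.card := by
  have : S = α.biUnion Prod.fst := by
    ext x; rw [h.2.2.1]; simp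
  rw [this, card_biUnion (fun p hp q hq hne => h.2.1 p hp q hq hne), card_eq_sum_ones, ← sum_add_distrib]
  exact sum_congr rfl (fun p hp => h.2.2.2 p hp)

variable {R : Type*} [CommRing R]

lemma Q_rec (u : (Fin k → ℕ) → R) (S : Finset (Fin n)) (x0 : Fin n) (hx0 : x0 ∈ S) (m : ℕ) :
    ∑ α ∈ (parts k S).filter (fun α => α.card = m+1), ∏ p ∈ α, u p.2 =
    ∑ C ∈ (S.erase x0).powerset, (∑ g ∈ Finset.Nat.antidiagonalTuple k C.card, u g) *
      ∑ α ∈ (parts k ((S.erase x0) \ C)).filter (fun α => α.card = m), ∏ p ∈ α, u p.2 := by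
  symm
  simp_rw [sum_mul_sum]
  simp_rw [sum_sigma']
  have key : ∀ (C : Finset (Fin n)) (g : Fin k → ℕ) (α : WP n k), C ⊆ S.erase x0 →
      g ∈ Finset.Nat.antidiagonalTuple k C.card → PartOn ((S.erase x0) \ C) α →
      (insert x0 C, g) ∉ α ∧ PartOn S (insert (insert x0 C, g) α) := by
    intro C g α hC hg hα
    have hx : x0 ∉ C := fun h => by simpa using hC h
    constructor
    · intro h
      have := hα.sub h (mem_insert_self _ _)
      simp at this
    · have h1 : PartOn (insert x0 C) ({(insert x0 C, g)} : WP n k) := by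
        apply partOn_singleton (p := (insert x0 C, g))
        rw [Finset.Nat.mem_antidiagonalTuple] at hg
        simp [WP.wsum, hg, card_insert_of_notMem hx]
      have h2 := h1.union hα (by
        rw [disjoint_left]; intro x hx hx'
        simp only [mem_insert, mem_sdiff, mem_erase] at hx hx'
        tauto)
      have e : insert x0 C ∪ (S.erase x0) \ C = S := by
        ext x
        have := @hC x
        simp only [mem_union, mem_insert, mem_sdiff, mem_erase] at this ⊢
        by_cases hxx : x = x0
        · subst hxx; simp [hx0]
        · tauto
      rw [e] at h2
      rwa [insert_eq]
  refine sum_bij (fun x _ => insert (insert x0 x.1, x.2.1) x.2.2) ?_ ?_ ?_ ?_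
  · rintro ⟨C, g, α⟩ h
    simp only [mem_sigma, mem_powerset, mem_filter, mem_parts] at h ⊢
    obtain ⟨h1, h2, h3, h4⟩ := h
    obtain ⟨k1, k2⟩ := key C g α h1 h2 h3
    exact ⟨k2, by rw [card_insert_of_notMem k1, h4]⟩
  · rintro ⟨C, g, α⟩ h ⟨C', g', α'⟩ h' heq
    simp only [mem_sigma, mem_powerset, mem_filter, mem_parts] at h h' heq
    obtain ⟨h1, h2, h3, h4⟩ := h
    obtain ⟨h1', h2', h3', h4'⟩ := h'
    obtain ⟨k1, k2⟩ := key C g α h1 h2 h3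
    obtain ⟨k1', k2'⟩ := key C' g' α' h1' h2' h3'
    have hx : x0 ∉ C := fun h => by simpa using h1 h
    have hx' : x0 ∉ C' := fun h => by simpa using h1' h
    have e := k2.block_unique (x := x0) (mem_insert_self _ _) (by rw [heq]; exact mem_insert_self (insert x0 C', g') α') (mem_insert_self _ _) (mem_insert_self x0 C')
    have eC : C = C' := by
      have := congrArg (fun p => p.1.erase x0) e
      simpa [erase_insert hx, erase_insert hx'] using this
    have eg : g = g' := congrArg Prod.snd e
    subst eC eg
    have : α = α' := by
      rw [← erase_insert k1, ← erase_insert k1', heq]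
    subst this
    rfl
  · intro β hβ
    simp only [mem_filter, mem_parts] at hβ
    obtain ⟨hβ, hc⟩ := hβ
    obtain ⟨p, hp, hxp⟩ := (hβ.2.2.1 x0).1 hx0
    have hins : insert x0 (p.1.erase x0) = p.1 := insert_erase hxp
    refine ⟨⟨p.1.erase x0, p.2, β.erase p⟩, ?_, ?_⟩
    · simp only [mem_sigma, mem_powerset, mem_filter, mem_parts]
      refine ⟨erase_subset_erase _ (hβ.sub hp), ?_, ?_, ?_⟩
      · rw [Finset.Nat.mem_antidiagonalTuple, card_erase_of_mem hxp, ← hβ.2.2.2 p hp]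
        simp [WP.wsum]
      · have := hβ.subset (erase_subset p β)
        convert this using 1
        ext x
        simp only [mem_sdiff, mem_erase, mem_biUnion, not_and]
        constructor
        · rintro ⟨⟨h1, h2⟩, h3⟩
          obtain ⟨q, hq, hxq⟩ := (hβ.2.2.1 x).1 h2
          refine ⟨q, ⟨?_, hq⟩, hxq⟩
          rintro rfl
          exact h3 h1 hxq
        · rintro ⟨q, ⟨hne, hq⟩, hxq⟩
          refine ⟨⟨?_, hβ.sub hq hxq⟩, ?_⟩
          · rintro rfl
            exact hne (hβ.block_unique hq hp hxq hxp)
          · intro _ h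
            exact hne (hβ.block_unique hq hp hxq h)
      · rw [card_erase_of_mem hp, hc]; rfl
    · simp only [hins]
      exact insert_erase hp
  · rintro ⟨C, g, α⟩ h
    simp only [mem_sigma, mem_powerset, mem_filter, mem_parts] at h ⊢
    obtain ⟨h1, h2, h3, h4⟩ := h
    obtain ⟨k1, k2⟩ := key C g α h1 h2 h3
    rw [prod_insert k1]

/-- partitions of `N` with `m` parts, as a finset -/
def ParF (N m : ℕ) : Finset (Multiset ℕ) :=
  ((univ : Finset (Nat.Partition N)).image Nat.Partition.parts).filter (fun l => l.card = m)

lemma mem_ParF {N m : ℕ} {l : Multiset ℕ} : l ∈ ParF N m ↔ l.sum = N ∧ l.card = m ∧ 0 ∉ l := by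
  simp only [ParF, mem_filter, mem_image, mem_univ, true_and]
  constructor
  · rintro ⟨⟨P, rfl⟩, h⟩
    exact ⟨P.parts_sum, h, fun h0 => absurd (P.parts_pos h0) (by simp)⟩
  · rintro ⟨h1, h2, h3⟩
    exact ⟨⟨⟨l, fun {i} hi => Nat.pos_of_ne_zero (fun h => h3 (h ▸ hi)), h1⟩, rfl⟩, h2⟩

lemma qcoef_cons (N s : ℕ) (l : Multiset ℕ) (hs : 1 ≤ s) (hsN : s ≤ N + 1) :
    ((s * (s ::ₘ l).count s : ℕ) : ℚ) / (N + 1) * qcoef (N+1) (s ::ₘ l) =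
      (N.choose (s-1) : ℚ) * qcoef (N - (s-1)) l := by
  obtain ⟨t, rfl⟩ : ∃ t, s = t + 1 := ⟨s - 1, by omega⟩
  simp only [Nat.add_sub_cancel]
  have hD : ((t+1) ::ₘ l).toFinset.prod (fun a => (((t+1) ::ₘ l).count a).factorial)
      = (l.count (t+1) + 1) * l.toFinset.prod (fun a => (l.count a).factorial) := by
    have e1 : l.toFinset.prod (fun a => (l.count a).factorial)
        = (insert (t+1) l.toFinset).prod (fun a => (l.count a).factorial) := by
      apply prod_subset (subset_insert _ _)
      intro x _ hx
      rw [Multiset.mem_toFinset] at hx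
      simp [Multiset.count_eq_zero.2 hx]
    rw [e1, Multiset.toFinset_cons]
    rw [← mul_prod_erase _ _ (mem_insert_self (t+1) l.toFinset),
      ← mul_prod_erase _ (fun a => (l.count a).factorial) (mem_insert_self (t+1) l.toFinset)]
    rw [Multiset.count_cons_self, Nat.factorial_succ, mul_assoc]
    congr 2
    apply prod_congr rfl
    intro x hx
    rw [Multiset.count_cons_of_ne (mem_erase.1 hx).1]
  unfold qcoef
  rw [hD, Multiset.count_cons_self, Multiset.map_cons, Multiset.prod_cons, Nat.cast_choose ℚ (by omega : t ≤ N)]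
  have a1 : (((l.map Nat.factorial).prod : ℕ) : ℚ) ≠ 0 := by
    rw [Nat.cast_ne_zero]
    apply Multiset.prod_ne_zero
    intro h
    obtain ⟨a, _, h⟩ := Multiset.mem_map.1 h
    exact Nat.factorial_ne_zero a h
  have a2 : ((l.toFinset.prod (fun a => (l.count a).factorial) : ℕ) : ℚ) ≠ 0 := by
    rw [Nat.cast_ne_zero]
    exact prod_ne_zero_iff.2 (fun a _ => Nat.factorial_ne_zero _)
  have a3 := Nat.factorial_ne_zero t
  have a4 := Nat.factorial_ne_zero (N - t)
  rw [Nat.factorial_succ, Nat.factorial_succ]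
  push_cast at a1 a2 ⊢
  field_simp

variable [Algebra ℚ R]

noncomputable def P (f : ℕ → R) (N m : ℕ) : R :=
  ∑ l ∈ ParF N m, qcoef N l • (l.map fun s => f (s - 1)).prod

lemma P_rec (f : ℕ → R) (N m : ℕ) :
    P f (N+1) (m+1) = ∑ t ∈ range (N+1), (N.choose t) • (f t * P f (N - t) m) := by
  have h1 : P f (N+1) (m+1) = ∑ l ∈ ParF (N+1) (m+1), ∑ s ∈ l.toFinset,
      (((s * l.count s : ℕ) : ℚ) / (N + 1) * qcoef (N+1) l) • (l.map fun s => f (s - 1)).prod := by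
    apply sum_congr rfl
    intro l hl
    rw [mem_ParF] at hl
    rw [← sum_smul, ← sum_mul, ← sum_div, ← Nat.cast_sum]
    have : ∑ s ∈ l.toFinset, s * l.count s = N + 1 := by
      rw [← hl.1, sum_multiset_count]
      exact sum_congr rfl (fun x _ => by simp [mul_comm])
    rw [this]
    push_cast
    rw [div_self (by positivity), one_mul]
  have h2 : ∑ t ∈ range (N+1), (N.choose t) • (f t * P f (N - t) m) =
      ∑ t ∈ range (N+1), ∑ l ∈ ParF (N-t) m,
        ((N.choose t : ℚ) * qcoef (N-t) l) • (f t * (l.map fun s => f (s - 1)).prod) := by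
    apply sum_congr rfl
    intro t _
    rw [P, mul_sum, smul_sum]
    apply sum_congr rfl
    intro l _
    rw [mul_smul, mul_smul_comm, Nat.cast_smul_eq_nsmul]
  rw [h1, h2]
  simp_rw [sum_sigma']
  symm
  refine sum_bij (fun x _ => ⟨(x.1+1) ::ₘ x.2, x.1+1⟩) ?_ ?_ ?_ ?_
  · rintro ⟨t, l⟩ h
    simp only [mem_sigma, mem_range, mem_ParF] at h ⊢
    obtain ⟨h1, h2, h3, h4⟩ := h
    refine ⟨⟨?_, ?_, ?_⟩, ?_⟩
    · rw [Multiset.sum_cons, h2]; omega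
    · simp [h3]
    · simp [h4]
    · simp
  · rintro ⟨t, l⟩ h ⟨t', l'⟩ h' heq
    simp only [Sigma.mk.injEq, heq_eq_eq, add_left_inj] at heq
    obtain ⟨h1, rfl⟩ := heq
    simp only [Multiset.cons_inj_right] at h1
    subst h1; rfl
  · rintro ⟨l, s⟩ h
    simp only [mem_sigma, mem_ParF, Multiset.mem_toFinset] at h
    obtain ⟨⟨h1, h2, h3⟩, h4⟩ := h
    have hs : s ≠ 0 := fun h => h3 (h ▸ h4)
    obtain ⟨l', rfl⟩ := Multiset.exists_cons_of_mem h4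
    obtain ⟨t, rfl⟩ : ∃ t, s = t + 1 := ⟨s - 1, by omega⟩
    simp only [Multiset.sum_cons, Multiset.card_cons, Multiset.mem_cons, not_or] at h1 h2 h3
    refine ⟨⟨t, l'⟩, ?_, rfl⟩
    simp only [mem_sigma, mem_range, mem_ParF]
    exact ⟨by omega, by omega, by omega, h3.2⟩
  · rintro ⟨t, l⟩ h
    simp only [mem_sigma, mem_range, mem_ParF] at h ⊢
    have := qcoef_cons N (t+1) l (by omega) (by omega)
    rw [this]
    simp

lemma Q_eq_P (u : (Fin k → ℕ) → R) (m : ℕ) : ∀ S : Finset (Fin n),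
    ∑ α ∈ (parts k S).filter (fun α => α.card = m), ∏ p ∈ α, u p.2 =
      P (fun t => ∑ g ∈ Finset.Nat.antidiagonalTuple k t, u g) S.card m := by
  induction m with
  | zero =>
    intro S
    rcases S.eq_empty_or_nonempty with rfl | hS
    · have e1 : (parts k (∅ : Finset (Fin n))).filter (fun α => α.card = 0) = {∅} := by
        ext α
        simp only [mem_filter, mem_parts, partOn_empty_iff, mem_singleton, card_eq_zero, and_self]
      have e2 : ParF 0 0 = {0} := by
        ext l
        simp only [mem_ParF, mem_singleton, Multiset.card_eq_zero]
        constructor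
        · exact fun h => h.2.1
        · rintro rfl; simp
      rw [e1, P, card_empty, e2]
      simp [qcoef]
    · rw [P]
      have e1 : (parts k S).filter (fun α => α.card = 0) = ∅ := by
        rw [eq_empty_iff_forall_notMem]
        intro α
        simp only [mem_filter, mem_parts, card_eq_zero]
        rintro ⟨h, rfl⟩
        obtain ⟨x, hx⟩ := hS
        obtain ⟨p, hp, _⟩ := (h.2.2.1 x).1 hx
        simp at hp
      have e2 : ParF S.card 0 = ∅ := by
        rw [eq_empty_iff_forall_notMem]
        intro l
        simp only [mem_ParF, Multiset.card_eq_zero]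
        rintro ⟨h, rfl, _⟩
        have := hS.card_pos
        simp at h; omega
      rw [e1, e2]; simp
  | succ m ih =>
    intro S
    rcases S.eq_empty_or_nonempty with rfl | ⟨x0, hx0⟩
    · rw [P]
      have e1 : (parts k (∅ : Finset (Fin n))).filter (fun α => α.card = m+1) = ∅ := by
        rw [eq_empty_iff_forall_notMem]
        intro α
        simp only [mem_filter, mem_parts, partOn_empty_iff]
        rintro ⟨rfl, h⟩
        simp at h
      have e2 : ParF (∅ : Finset (Fin n)).card (m+1) = ∅ := by
        rw [eq_empty_iff_forall_notMem]
        intro l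
        simp only [mem_ParF, card_empty]
        rintro ⟨h, h2, h3⟩
        have : l ≠ 0 := by rintro rfl; simp at h2
        obtain ⟨a, ha⟩ := Multiset.exists_mem_of_ne_zero this
        have := Multiset.single_le_sum (fun _ _ => Nat.zero_le _) a ha
        have : a = 0 := by omega
        exact h3 (this ▸ ha)
      rw [e1, e2]; simp
    · rw [Q_rec u S x0 hx0 m]
      have hc : S.card = (S.erase x0).card + 1 := (card_erase_add_one hx0).symm
      rw [hc, P_rec]
      rw [← sum_powerset_apply_card (fun t => (∑ g ∈ Finset.Nat.antidiagonalTuple k t, u g) *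
        P (fun t => ∑ g ∈ Finset.Nat.antidiagonalTuple k t, u g) ((S.erase x0).card - t) m)]
      apply sum_congr rfl
      intro C hC
      rw [ih, card_sdiff_of_subset (mem_powerset.1 hC)]

end WW

namespace WW
open Finset
open CTree

variable {n k : ℕ}

lemma minLeaf_mem (T : CTree) : T.minLeaf ∈ T.leavesList := by
  induction T with
  | leaf a => simp [minLeaf, leavesList]
  | node c l r hl hr =>
    simp only [minLeaf, leavesList, List.mem_append]
    rcases min_choice l.minLeaf r.minLeaf with h | h <;> rw [h]
    · exact Or.inl hl
    · exact Or.inr hr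

lemma minLeaf_le (T : CTree) : ∀ x ∈ T.leavesList, T.minLeaf ≤ x := by
  induction T with
  | leaf a => simp [minLeaf, leavesList]
  | node c l r hl hr =>
    intro x hx
    simp only [minLeaf, leavesList, List.mem_append] at hx ⊢
    rcases hx with h | h
    · exact (min_le_left _ _).trans (hl x h)
    · exact (min_le_right _ _).trans (hr x h)

lemma rootLyndon_leaf (c a : ℕ) (r : CTree) : RootLyndonB (node c (leaf a) r) = true := by
  simp [RootLyndonB, isLeafB, CTree.left]

lemma rootLyndon_node (c c' : ℕ) (l' r' r : CTree) :
    RootLyndonB (node c (node c' l' r') r) = true ↔ r.minLeaf < r'.minLeaf := by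
  have : RootLyndonB (node c (node c' l' r') r) = decide (r.minLeaf < r'.minLeaf) := rfl
  rw [this, decide_eq_true_iff]

/-- extension of a weight vector by zero -/
def ext0 (g : Fin k → ℕ) (j : ℕ) : ℕ := if h : j < k then g ⟨j, h⟩ else 0

lemma ext0_ge (g : Fin k → ℕ) {j : ℕ} (h : k ≤ j) : ext0 g j = 0 := by
  simp [ext0, not_lt.2 h]

lemma ext0_val (g : Fin k → ℕ) (i : Fin k) : ext0 g i = g i := by
  simp [ext0]

lemma sum_ext0 (g : Fin k → ℕ) : ∑ j ∈ range k, ext0 g j = WP.wsum g := by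
  rw [WP.wsum, ← Fin.sum_univ_eq_sum_range]
  simp [ext0_val]

/-- Lyndon trees with label set `A` and weight `g` -/
def LT (A : Finset ℕ) (g : Fin k → ℕ) : Set CTree :=
  {T | T.leavesList.Nodup ∧ T.leavesList.toFinset = A ∧ T.Normalized ∧ T.LynColored ∧
    ∀ j, T.colorCount j = ext0 g j}

lemma LynSetF_eq (N : ℕ) (g : Fin k → ℕ) :
    LynSetF N k g = LT ((range N).image (· + 1)) g := by
  have hnd : ((List.range N).map (· + 1)).Nodup :=
    List.Nodup.map (fun a b h => by simpa using h) List.nodup_range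
  have hf : ((List.range N).map (· + 1)).toFinset = (range N).image (· + 1) := by
    ext x; simp
  ext T
  simp only [LynSetF, LT, Set.mem_ofPred_eq, OnSet, ← hf, ext0]
  constructor
  · rintro ⟨h, h'⟩
    exact ⟨h.nodup_iff.2 hnd, List.toFinset_eq_of_perm _ _ h, h'⟩
  · rintro ⟨h1, h2, h3⟩
    exact ⟨List.perm_of_nodup_nodup_toFinset_eq h1 hnd h2, h3⟩

lemma finite_trees (k : ℕ) (A : Finset ℕ) (N : ℕ) :
    {T : CTree | T.leavesList.length ≤ N ∧ (∀ x ∈ T.leavesList, x ∈ A) ∧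
      ∀ j, k ≤ j → T.colorCount j = 0}.Finite := by
  have hpos : ∀ T : CTree, 0 < T.leavesList.length := fun T =>
    List.length_pos_of_mem (minLeaf_mem T)
  induction N with
  | zero =>
    convert Set.finite_empty
    ext T
    have := hpos T
    simp only [Set.mem_ofPred_eq, Set.mem_empty_iff_false, iff_false]
    omega
  | succ N ih =>
    refine Set.Finite.subset ((A.finite_toSet.image CTree.leaf).union
      (((range k).finite_toSet.prod (ih.prod ih)).image (fun x => CTree.node x.1 x.2.1 x.2.2))) ?_
    rintro T ⟨h1, h2, h3⟩
    cases T with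
    | leaf a => left; exact ⟨a, by simpa [leavesList] using h2, rfl⟩
    | node c l r =>
      right
      have := hpos l
      have := hpos r
      simp only [leavesList, List.length_append, List.mem_append, colorCount] at h1 h2 h3
      refine ⟨(c, l, r), ?_, rfl⟩
      simp only [Set.mem_prod, Set.mem_ofPred_eq, coe_range, Set.mem_Iio]
      refine ⟨?_, ⟨by omega, fun x hx => h2 x (Or.inl hx), fun j hj => ?_⟩,
        ⟨by omega, fun x hx => h2 x (Or.inr hx), fun j hj => ?_⟩⟩
      · by_contra hc
        have := h3 c (by omega)
        simp at this
      · have := h3 j hj; omega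
      · have := h3 j hj; omega

lemma LT_finite (A : Finset ℕ) (g : Fin k → ℕ) : (LT A g).Finite := by
  refine (finite_trees k A A.card).subset ?_
  rintro T ⟨h1, h2, h3, h4, h5⟩
  refine ⟨?_, ?_, ?_⟩
  · rw [← h2, List.toFinset_card_of_nodup h1]
  · intro x hx; rw [← h2]; simpa using hx
  · intro j hj; rw [h5, ext0_ge g hj]

/-- relabelling -/
def mapL (φ : ℕ → ℕ) : CTree → CTree
  | leaf a => leaf (φ a)
  | node c l r => node c (mapL φ l) (mapL φ r)

lemma leaves_mapL (φ : ℕ → ℕ) (T : CTree) : (mapL φ T).leavesList = T.leavesList.map φ := by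
  induction T with
  | leaf a => simp [mapL, leavesList]
  | node c l r hl hr => simp [mapL, leavesList, hl, hr]

lemma colorCount_mapL (φ : ℕ → ℕ) (T : CTree) (j : ℕ) :
    (mapL φ T).colorCount j = T.colorCount j := by
  induction T with
  | leaf a => simp [mapL, colorCount]
  | node c l r hl hr => simp [mapL, colorCount, hl, hr]

lemma minLeaf_mapL (φ : ℕ → ℕ) (A : Set ℕ) (hφ : StrictMonoOn φ A) (T : CTree)
    (hT : ∀ x ∈ T.leavesList, x ∈ A) : (mapL φ T).minLeaf = φ T.minLeaf := by
  apply le_antisymm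
  · apply minLeaf_le
    rw [leaves_mapL]
    exact List.mem_map_of_mem (minLeaf_mem T)
  · have := minLeaf_mem (mapL φ T)
    rw [leaves_mapL, List.mem_map] at this
    obtain ⟨x, hx, h⟩ := this
    rw [← h]
    exact (hφ.le_iff_le (hT _ (minLeaf_mem T)) (hT x hx)).2 (minLeaf_le T x hx)

lemma rootColor_mapL (φ : ℕ → ℕ) (T : CTree) : (mapL φ T).rootColor = T.rootColor := by
  cases T <;> rfl

lemma normalized_mapL (φ : ℕ → ℕ) (A : Set ℕ) (hφ : StrictMonoOn φ A) (T : CTree)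
    (hT : ∀ x ∈ T.leavesList, x ∈ A) (h : T.Normalized) : (mapL φ T).Normalized := by
  induction T with
  | leaf a => trivial
  | node c l r hl hr =>
    simp only [leavesList, List.mem_append] at hT
    have tl := fun x hx => hT x (Or.inl hx)
    have tr := fun x hx => hT x (Or.inr hx)
    refine ⟨hl tl h.1, hr tr h.2.1, ?_⟩
    rw [minLeaf_mapL φ A hφ l tl, minLeaf_mapL φ A hφ r tr]
    exact hφ (tl _ (minLeaf_mem l)) (tr _ (minLeaf_mem r)) h.2.2

lemma lyn_mapL (φ : ℕ → ℕ) (A : Set ℕ) (hφ : StrictMonoOn φ A) (T : CTree)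
    (hT : ∀ x ∈ T.leavesList, x ∈ A) (h : T.LynColored) : (mapL φ T).LynColored := by
  induction T with
  | leaf a => trivial
  | node c l r hl hr =>
    simp only [leavesList, List.mem_append] at hT
    have tl := fun x hx => hT x (Or.inl hx)
    have tr := fun x hx => hT x (Or.inr hx)
    refine ⟨hl tl h.1, hr tr h.2.1, ?_⟩
    refine h.2.2.imp ?_ ?_
    · intro h'
      cases l with
      | leaf a => simp [RootLyndonB, isLeafB, CTree.left, mapL]
      | node c' l' r' =>
        simp only [leavesList, List.mem_append] at tl
        have tr' := fun x hx => tl x (Or.inr hx)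
        simp only [mapL]
        rw [rootLyndon_node] at h' ⊢
        rw [minLeaf_mapL φ A hφ r' tr', minLeaf_mapL φ A hφ r tr]
        exact hφ (tr _ (minLeaf_mem r)) (tr' _ (minLeaf_mem r')) h'
    · rw [rootColor_mapL]; exact id

lemma mapL_inj (φ : ℕ → ℕ) (A : Set ℕ) (hφ : Set.InjOn φ A) (T T' : CTree)
    (hT : ∀ x ∈ T.leavesList, x ∈ A) (hT' : ∀ x ∈ T'.leavesList, x ∈ A)
    (h : mapL φ T = mapL φ T') : T = T' := by
  induction T generalizing T' with
  | leaf a =>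
    cases T' with
    | leaf b =>
      simp only [mapL, leaf.injEq, leavesList, List.mem_singleton, forall_eq] at *
      exact hφ hT hT' h
    | node => simp [mapL] at h
  | node c l r hl hr =>
    cases T' with
    | leaf b => simp [mapL] at h
    | node c' l' r' =>
      simp only [leavesList, List.mem_append, mapL, node.injEq] at *
      rw [h.1, hl l' (fun x hx => hT x (Or.inl hx)) (fun x hx => hT' x (Or.inl hx)) h.2.1,
        hr r' (fun x hx => hT x (Or.inr hx)) (fun x hx => hT' x (Or.inr hx)) h.2.2]
      simp

lemma LT_card_le (A A' : Finset ℕ) (hA : A.card = A'.card) (g : Fin k → ℕ) :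
    Nat.card (LT A g) ≤ Nat.card (LT A' g) := by
  obtain ⟨φ, hφ, him⟩ : ∃ φ : ℕ → ℕ, StrictMonoOn φ A ∧ A.image φ = A' := by
    let e := (A.orderIsoOfFin rfl).symm.trans (A'.orderIsoOfFin hA.symm)
    refine ⟨fun x => if h : x ∈ A then e ⟨x, h⟩ else 0, ?_, ?_⟩
    · intro x hx y hy hxy
      have hx' : x ∈ A := hx
      have hy' : y ∈ A := hy
      simp only [hx', hy', dif_pos]
      exact e.strictMono (show (⟨x, hx'⟩ : A) < ⟨y, hy'⟩ from hxy)
    · ext y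
      simp only [mem_image]
      constructor
      · rintro ⟨x, hx, rfl⟩
        simp only [hx, dif_pos]
        exact (e ⟨x, hx⟩).2
      · intro hy
        refine ⟨e.symm ⟨y, hy⟩, (e.symm ⟨y, hy⟩).2, ?_⟩
        simp
  have : Finite (LT A' g) := LT_finite A' g
  have hsub : ∀ T ∈ LT A g, ∀ x ∈ T.leavesList, x ∈ (A : Set ℕ) := by
    rintro T ⟨h1, h2, h3, h4, h5⟩ x hx
    rw [← h2]; simpa using hx
  refine Nat.card_le_card_of_injective (fun T : LT A g => (⟨mapL φ T.1, ?_⟩ : LT A' g)) ?_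
  · obtain ⟨T, hT⟩ := T
    have hs := hsub T hT
    obtain ⟨h1, h2, h3, h4, h5⟩ := hT
    refine ⟨?_, ?_, normalized_mapL φ A hφ T hs h3, lyn_mapL φ A hφ T hs h4, ?_⟩
    · rw [leaves_mapL]
      exact h1.map_on (fun x hx y hy h => hφ.injOn (hs x hx) (hs y hy) h)
    · have e : (T.leavesList.map φ).toFinset = A' := by
        rw [← him, ← h2]; ext; simp
      rw [leaves_mapL]
      exact e
    · intro j; rw [colorCount_mapL, h5]
  · rintro ⟨T, hT⟩ ⟨T', hT'⟩ h
    simp only [Subtype.mk.injEq] at h ⊢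
    exact mapL_inj φ A hφ.injOn T T' (hsub T hT) (hsub T' hT') h

/-- `|Lyn_g|` -/
noncomputable def ell (g : Fin k → ℕ) : ℕ := Nat.card (LynSetF (WP.wsum g + 1) k g)

lemma LT_card (A : Finset ℕ) (g : Fin k → ℕ) (h : WP.wsum g + 1 = A.card) :
    Nat.card (LT A g) = ell g := by
  rw [ell, LynSetF_eq]
  have : A.card = ((range (WP.wsum g + 1)).image (· + 1)).card := by
    rw [card_image_of_injective _ (add_left_injective 1), card_range, h]
  exact le_antisymm (LT_card_le _ _ this g) (LT_card_le _ _ this.symm g)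

end WW

namespace WW
open Finset
open CTree

variable {n k : ℕ}

/-- number of internal nodes of color `j` in a list of trees -/
def cnt (ts : List CTree) (j : ℕ) : ℕ := (ts.map (fun T => T.colorCount j)).sum

lemma cnt_cons (T : CTree) (ts : List CTree) (j : ℕ) :
    cnt (T :: ts) j = T.colorCount j + cnt ts j := by simp [cnt]

/-- the concatenated list of leaves of a list of trees -/
def lvs (ts : List CTree) : List ℕ := ts.flatMap leavesList

lemma lvs_cons (T : CTree) (ts : List CTree) : lvs (T :: ts) = T.leavesList ++ lvs ts := by
  simp [lvs]

/-- sorted forests of Lyndon trees with label set `A` and weight at most `ν` -/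
structure IsFor (A : Finset ℕ) (ν : Fin k → ℕ) (ts : List CTree) : Prop where
  sorted : ts.Pairwise (fun T T' => T.minLeaf < T'.minLeaf)
  good : ∀ T ∈ ts, T.Normalized ∧ T.LynColored
  nodup : (lvs ts).Nodup
  labels : (lvs ts).toFinset = A
  wt : ∀ j, cnt ts j ≤ ext0 ν j

lemma tree_count (T : CTree) (h : ∀ j, k ≤ j → T.colorCount j = 0) :
    ∑ j ∈ range k, T.colorCount j + 1 = T.leavesList.length := by
  induction T with
  | leaf a => simp [colorCount, leavesList]
  | node c l r hl hr =>
    simp only [colorCount] at h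
    have hl' := hl (fun j hj => by have := h j hj; omega)
    have hr' := hr (fun j hj => by have := h j hj; omega)
    have hc : c < k := by
      by_contra hc
      have := h c (by omega)
      simp at this
    simp only [colorCount, leavesList, List.length_append, sum_add_distrib]
    rw [sum_ite_eq, if_pos (mem_range.2 hc)]
    omega

lemma list_count (ts : List CTree) (h : ∀ j, k ≤ j → cnt ts j = 0) :
    ∑ j ∈ range k, cnt ts j + ts.length = (lvs ts).length := by
  induction ts with
  | nil => simp [cnt, lvs]
  | cons T ts ih =>
    simp only [cnt_cons] at h
    have h1 := ih (fun j hj => by have := h j hj; omega)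
    have h2 := tree_count (k := k) T (fun j hj => by have := h j hj; omega)
    simp only [cnt_cons, lvs_cons, sum_add_distrib, List.length_append, List.length_cons]
    omega

variable {A : Finset ℕ} {ν : Fin k → ℕ} {ts : List CTree}

lemma IsFor.zero (h : IsFor A ν ts) (j : ℕ) (hj : k ≤ j) : cnt ts j = 0 := by
  have := h.wt j
  rw [ext0_ge ν hj] at this
  omega

lemma IsFor.total (h : IsFor A ν ts) : ∑ j ∈ range k, cnt ts j + ts.length = A.card := by
  rw [list_count ts h.zero, ← h.labels, List.toFinset_card_of_nodup h.nodup]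

/-- smallest residual color -/
noncomputable def c1 (ν : Fin k → ℕ) (ts : List CTree) : ℕ := sInf {j | cnt ts j < ext0 ν j}

lemma IsFor.c1_mem (h : IsFor A ν ts) (hν : WP.wsum ν + 1 = A.card) (hl : 2 ≤ ts.length) :
    cnt ts (c1 ν ts) < ext0 ν (c1 ν ts) := by
  have hne : {j | cnt ts j < ext0 ν j}.Nonempty := by
    by_contra hne
    have h0 : ∀ j, ext0 ν j ≤ cnt ts j := by
      intro j
      by_contra hj
      exact hne ⟨j, not_le.1 hj⟩
    have h1 := h.total
    have h2 : ∑ j ∈ range k, ext0 ν j ≤ ∑ j ∈ range k, cnt ts j := sum_le_sum (fun j _ => h0 j)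
    rw [sum_ext0] at h2
    omega
  exact Nat.sInf_mem hne

lemma c1_lt {j : ℕ} (hj : j < c1 ν ts) : ¬ cnt ts j < ext0 ν j := fun h => Nat.notMem_of_lt_sInf (s := {j | cnt ts j < ext0 ν j}) hj h

lemma c1_le {j : ℕ} (hj : cnt ts j < ext0 ν j) : c1 ν ts ≤ j := Nat.sInf_le hj

lemma IsFor.single_eq (h : IsFor A ν ts) (hν : WP.wsum ν + 1 = A.card) (hl : ts.length = 1) (j : ℕ) :
    ¬ cnt ts j < ext0 ν j := by
  rcases lt_or_ge j k with hj | hj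
  · have h1 := h.total
    intro hlt
    have h2 : ∑ j ∈ range k, cnt ts j < ∑ j ∈ range k, ext0 ν j :=
      sum_lt_sum (fun j _ => h.wt j) ⟨j, mem_range.2 hj, hlt⟩
    rw [sum_ext0] at h2
    omega
  · rw [ext0_ge ν hj]; omega

/-- bad links -/
def Bad (l : CTree) (c : ℕ) (r : CTree) : Prop :=
  match l with
  | leaf _ => False
  | node c' _ r' => c' ≤ c ∧ r'.minLeaf < r.minLeaf

lemma lyn_of_not_bad {l r : CTree} {c : ℕ} (hd : (l.leavesList ++ r.leavesList).Nodup)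
    (h : ¬ Bad l c r) : RootLyndonB (node c l r) = true ∨ c < rootColor l := by
  cases l with
  | leaf a => left; exact rootLyndon_leaf c a r
  | node c' l' r' =>
    simp only [Bad, not_and_or, not_le, not_lt] at h
    rw [rootLyndon_node]
    rcases h with h | h
    · exact Or.inr h
    · left
      refine lt_of_le_of_ne h ?_
      intro he
      rw [List.nodup_append'] at hd
      have hdd := hd.2.2
      refine hdd (a := r.minLeaf) ?_ (minLeaf_mem r)
      rw [he]
      simp [leavesList, minLeaf_mem]

lemma not_bad_of_lyn {l r : CTree} {c : ℕ}
    (h : RootLyndonB (node c l r) = true ∨ c < rootColor l) : ¬ Bad l c r := by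
  cases l with
  | leaf a => simp [Bad]
  | node c' l' r' =>
    rw [rootLyndon_node] at h
    simp only [Bad, rootColor] at h ⊢
    omega

lemma IsFor.merge {T T2 : CTree} {R : List CTree} {c : ℕ} (h : IsFor A ν (T :: T2 :: R))
    (hc : cnt (T :: T2 :: R) c < ext0 ν c) (hb : ¬ Bad T c T2) : IsFor A ν (node c T T2 :: R) := by
  have hlv : lvs (node c T T2 :: R) = lvs (T :: T2 :: R) := by
    simp [lvs_cons, leavesList]
  have hs := h.sorted
  simp only [List.pairwise_cons, List.mem_cons, forall_eq_or_imp] at hs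
  obtain ⟨⟨h1, h2⟩, h3, h4⟩ := hs
  have hg := h.good
  simp only [List.mem_cons, forall_eq_or_imp] at hg
  obtain ⟨g1, g2, g3⟩ := hg
  have hnd : (T.leavesList ++ T2.leavesList).Nodup := by
    have := h.nodup
    rw [lvs_cons, lvs_cons, ← List.append_assoc] at this
    exact this.of_append_left
  refine ⟨?_, ?_, hlv ▸ h.nodup, hlv ▸ h.labels, ?_⟩
  · rw [List.pairwise_cons]
    refine ⟨fun a ha => ?_, h4⟩
    simp only [minLeaf]
    exact lt_of_le_of_lt (min_le_left _ _) (h2 a ha)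
  · simp only [List.mem_cons, forall_eq_or_imp]
    exact ⟨⟨⟨g1.1, g2.1, h1⟩, ⟨g1.2, g2.2, lyn_of_not_bad hnd hb⟩⟩, g3⟩
  · intro j
    have := h.wt j
    simp only [cnt_cons, colorCount] at this hc ⊢
    split_ifs with hj
    · subst hj; omega
    · omega

lemma IsFor.pull {l r : CTree} {R : List CTree} {c : ℕ} (h : IsFor A ν (node c l r :: R))
    (hr : ∀ T ∈ R, r.minLeaf < T.minLeaf) : IsFor A ν (l :: r :: R) ∧ ¬ Bad l c r := by
  have hlv : lvs (node c l r :: R) = lvs (l :: r :: R) := by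
    simp [lvs_cons, leavesList]
  have hs := h.sorted
  simp only [List.pairwise_cons] at hs
  have hg := h.good
  simp only [List.mem_cons, forall_eq_or_imp] at hg
  obtain ⟨⟨⟨g1, g2, g3⟩, ⟨g4, g5, g6⟩⟩, g7⟩ := hg
  refine ⟨⟨?_, ?_, hlv ▸ h.nodup, hlv ▸ h.labels, ?_⟩, not_bad_of_lyn g6⟩
  · simp only [List.pairwise_cons, List.mem_cons, forall_eq_or_imp]
    exact ⟨⟨g3, fun a ha => g3.trans (hr a ha)⟩, hr, hs.2⟩
  · simp only [List.mem_cons, forall_eq_or_imp]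
    exact ⟨⟨g1, g4⟩, ⟨g2, g5⟩, g7⟩
  · intro j
    have := h.wt j
    simp only [cnt_cons, colorCount] at this ⊢
    omega

/-- split off the root -/
def unf : CTree → List CTree
  | leaf a => [leaf a]
  | node _ l r => [l, r]

open Classical in
/-- the sign-reversing involution -/
noncomputable def inv (ν : Fin k → ℕ) : List CTree → List CTree
  | [] => []
  | [T] => unf T
  | T :: T2 :: R => if Bad T (c1 ν (T :: T2 :: R)) T2 then unf T ++ (T2 :: R)
      else node (c1 ν (T :: T2 :: R)) T T2 :: R

/-- pull situation: everything about `inv` applied to it -/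
lemma pull_inv {l r : CTree} {R : List CTree} {c : ℕ} (h : IsFor A ν (node c l r :: R))
    (hr : ∀ T ∈ R, r.minLeaf < T.minLeaf)
    (hc : ∀ j < c, ¬ cnt (node c l r :: R) j < ext0 ν j) :
    inv ν (l :: r :: R) = node c l r :: R := by
  have hc1 : c1 ν (l :: r :: R) = c := by
    apply le_antisymm
    · apply c1_le
      have := h.wt c
      simp only [cnt_cons, colorCount, if_true] at this ⊢
      omega
    · by_contra hlt
      rw [not_le] at hlt
      have h1 := hc _ hlt
      have hp := (h.pull hr).1
      have h2 : cnt (l :: r :: R) (c1 ν (l :: r :: R)) < ext0 ν (c1 ν (l :: r :: R)) := by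
        apply Nat.sInf_mem (s := {j | cnt (l :: r :: R) j < ext0 ν j})
        refine ⟨c, ?_⟩
        have := h.wt c
        simp only [cnt_cons, colorCount, if_true, Set.mem_ofPred_eq] at this ⊢
        omega
      have h3 : c ≠ c1 ν (l :: r :: R) := by omega
      generalize c1 ν (l :: r :: R) = d at *
      simp only [cnt_cons, colorCount, if_neg h3] at h1 h2
      omega
  have hb := (h.pull hr).2
  rw [← hc1] at hb
  rw [inv, if_neg hb, hc1]

lemma inv_spec (hν : WP.wsum ν + 1 = A.card) (hA : 2 ≤ A.card) (h : IsFor A ν ts) :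
    IsFor A ν (inv ν ts) ∧ inv ν (inv ν ts) = ts ∧
      (-1 : ℤ) ^ ts.length + (-1) ^ (inv ν ts).length = 0 := by
  match ts, h with
  | [], h =>
    have := h.labels
    simp [lvs] at this
    subst this
    simp at hA
  | [leaf a], h =>
    have := h.labels
    simp [lvs, leavesList] at this
    subst this
    simp at hA
  | [node c l r], h =>
    have hr : ∀ T ∈ ([] : List CTree), r.minLeaf < T.minLeaf := by simp
    have h2 := pull_inv h hr (fun j _ => h.single_eq hν rfl j)
    refine ⟨(h.pull hr).1, h2, ?_⟩
    simp [inv, unf]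
  | T :: T2 :: R, h =>
    by_cases hb : Bad T (c1 ν (T :: T2 :: R)) T2
    · cases T with
      | leaf a => simp [Bad] at hb
      | node c l r =>
        have e : inv ν (node c l r :: T2 :: R) = l :: r :: T2 :: R := by
          simp [inv, if_pos hb, unf]
        have hr : ∀ T ∈ T2 :: R, r.minLeaf < T.minLeaf := by
          have hs := h.sorted
          simp only [List.pairwise_cons] at hs
          simp only [List.mem_cons, forall_eq_or_imp]
          exact ⟨hb.2, fun a ha => hb.2.trans (hs.2.1 a ha)⟩
        have h2 := pull_inv h hr (fun j hj => c1_lt (lt_of_lt_of_le hj hb.1))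
        rw [e]
        refine ⟨(h.pull hr).1, h2, ?_⟩
        simp only [List.length_cons]; ring
    · have e : inv ν (T :: T2 :: R) = node (c1 ν (T :: T2 :: R)) T T2 :: R := by
        simp [inv, if_neg hb]
      have hm := h.c1_mem hν (by simp)
      have hf := h.merge hm hb
      rw [e]
      refine ⟨hf, ?_, by simp only [List.length_cons]; ring⟩
      cases R with
      | nil => simp [inv, unf]
      | cons T3 R =>
        have hb' : Bad (node (c1 ν (T :: T2 :: T3 :: R)) T T2)
            (c1 ν (node (c1 ν (T :: T2 :: T3 :: R)) T T2 :: T3 :: R)) T3 := by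
          refine ⟨?_, ?_⟩
          · have := hf.c1_mem hν (by simp)
            apply c1_le
            refine lt_of_le_of_lt ?_ this
            simp only [cnt_cons, colorCount]
            omega
          · have hs := h.sorted
            simp only [List.pairwise_cons, List.mem_cons, forall_eq_or_imp] at hs
            exact hs.2.1.1
        rw [inv, if_pos hb']
        simp [unf]

lemma forest_sum_zero (hν : WP.wsum ν + 1 = A.card) (hA : 2 ≤ A.card) (F : Finset (List CTree))
    (hF : ∀ ts, ts ∈ F ↔ IsFor A ν ts) : ∑ ts ∈ F, (-1 : ℤ) ^ ts.length = 0 := by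
  refine sum_involution (fun ts _ => inv ν ts) ?_ ?_ ?_ ?_
  · intro ts h
    exact (inv_spec hν hA ((hF ts).1 h)).2.2
  · intro ts h h0 he
    have := (inv_spec hν hA ((hF ts).1 h)).2.2
    rw [he] at this
    omega
  · intro ts h
    exact (hF _).2 (inv_spec hν hA ((hF ts).1 h)).1
  · intro ts h
    exact (inv_spec hν hA ((hF ts).1 h)).2.1

end WW

namespace WW
open Finset
open CTree

variable {n k : ℕ}

/-- label set of a block -/
def lab (B : Finset (Fin n)) : Finset ℕ := B.map Fin.valEmbedding

lemma mem_lab {B : Finset (Fin n)} {x : ℕ} : x ∈ lab B ↔ ∃ y ∈ B, (y : ℕ) = x := by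
  simp [lab]

lemma val_mem_lab {B : Finset (Fin n)} {x : Fin n} : (x : ℕ) ∈ lab B ↔ x ∈ B := by
  rw [mem_lab]
  constructor
  · rintro ⟨y, hy, h⟩
    rwa [← Fin.ext h]
  · intro h; exact ⟨x, h, rfl⟩

lemma card_lab (B : Finset (Fin n)) : (lab B).card = B.card := card_map _

/-- the weighted block of a tree -/
def pt (n k : ℕ) (T : CTree) : Finset (Fin n) × (Fin k → ℕ) :=
  (univ.filter (fun x : Fin n => (x : ℕ) ∈ T.leavesList), fun i => T.colorCount i)

/-- `T` is a Lyndon tree for the weighted block `p` -/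
def LTp (p : Finset (Fin n) × (Fin k → ℕ)) : Set CTree := LT (lab p.1) p.2

lemma pt_eq {p : Finset (Fin n) × (Fin k → ℕ)} {T : CTree} (h : T ∈ LTp p) : pt n k T = p := by
  obtain ⟨h1, h2, h3, h4, h5⟩ := h
  refine Prod.ext ?_ ?_
  · ext x
    rw [← val_mem_lab (B := p.1), ← h2]
    simp [pt]
  · funext i
    simp only [pt]
    rw [h5, ext0_val]

noncomputable def sec : List (Finset (Fin n) × (Fin k → ℕ)) → Finset (List CTree)
  | [] => {[]}
  | p :: L => image₂ List.cons (LT_finite (lab p.1) p.2).toFinset (sec L)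

lemma mem_sec (L : List (Finset (Fin n) × (Fin k → ℕ))) (ts : List CTree) :
    ts ∈ sec L ↔ ts.map (pt n k) = L ∧ ∀ T ∈ ts, T ∈ LTp (pt n k T) := by
  induction L generalizing ts with
  | nil =>
    simp only [sec, mem_singleton, List.map_eq_nil_iff]
    constructor
    · rintro rfl; simp
    · exact fun h => h.1
  | cons p L ih =>
    simp only [sec, mem_image₂, Set.Finite.mem_toFinset]
    constructor
    · rintro ⟨T, hT, ts', hts, rfl⟩
      have e := pt_eq (p := p) hT
      rw [ih] at hts
      simp only [List.map_cons, e, hts.1, List.mem_cons, forall_eq_or_imp]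
      exact ⟨trivial, hT, hts.2⟩
    · cases ts with
      | nil => simp
      | cons T ts =>
        simp only [List.map_cons, List.cons.injEq, List.mem_cons, forall_eq_or_imp]
        rintro ⟨⟨h1, h2⟩, h3, h4⟩
        refine ⟨T, ?_, ts, (ih ts).2 ⟨h2, h4⟩, rfl, rfl⟩
        rw [h1] at h3
        exact h3

lemma card_sec (L : List (Finset (Fin n) × (Fin k → ℕ)))
    (hL : ∀ p ∈ L, WP.wsum p.2 + 1 = p.1.card) :
    (sec L).card = (L.map (fun p => ell p.2)).prod := by
  induction L with
  | nil => simp [sec]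
  | cons p L ih =>
    simp only [List.mem_cons, forall_eq_or_imp] at hL
    rw [sec, card_image₂ (fun a b c d h => by simpa using h), ih hL.2, List.map_cons, List.prod_cons,
      ← LT_card (lab p.1) p.2 (by rw [card_lab]; exact hL.1),
      Nat.card_eq_card_finite_toFinset (LT_finite (lab p.1) p.2)]

noncomputable def bmin (B : Finset (Fin n)) : ℕ := sInf {j | j ∈ lab B}

lemma bmin_mem {B : Finset (Fin n)} (h : B.Nonempty) : bmin B ∈ lab B := by
  obtain ⟨x, hx⟩ := h
  exact Nat.sInf_mem (s := {j | j ∈ lab B}) ⟨x, val_mem_lab.2 hx⟩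

lemma minLeaf_eq {p : Finset (Fin n) × (Fin k → ℕ)} {T : CTree} (h : T ∈ LTp p) :
    T.minLeaf = bmin p.1 := by
  obtain ⟨h1, h2, h3, h4, h5⟩ := h
  have hm : T.minLeaf ∈ lab p.1 := by rw [← h2]; simpa using minLeaf_mem T
  apply le_antisymm
  · apply minLeaf_le
    have : bmin p.1 ∈ lab p.1 := Nat.sInf_mem (s := {j | j ∈ lab p.1}) ⟨_, hm⟩
    rw [← h2] at this
    simpa using this
  · exact Nat.sInf_le hm

lemma exists_sorted {S : Finset (Fin n)} {α : WP n k} (h : PartOn S α) :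
    ∃ L : List (Finset (Fin n) × (Fin k → ℕ)), L.Nodup ∧ L.toFinset = α ∧
      L.Pairwise (fun p q => bmin p.1 < bmin q.1) := by
  have hinj : ∀ p ∈ α, ∀ q ∈ α, bmin p.1 = bmin q.1 → p = q := by
    intro p hp q hq he
    have h1 := bmin_mem (h.1 p hp)
    have h2 := bmin_mem (h.1 q hq)
    rw [mem_lab] at h1 h2
    obtain ⟨x, hx, h1⟩ := h1
    obtain ⟨y, hy, h2⟩ := h2
    have : x = y := Fin.ext (by omega)
    subst this
    exact h.block_unique hp hq hx hy
  clear h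
  induction α using Finset.induction_on_max_value (fun p : Finset (Fin n) × (Fin k → ℕ) => bmin p.1) with
  | empty => exact ⟨[], by simp⟩
  | insert a s ha hm ih =>
    obtain ⟨L, h1, h2, h3⟩ := ih (fun p hp q hq => hinj p (mem_insert_of_mem hp) q (mem_insert_of_mem hq))
    have hmem : ∀ p, p ∈ L ↔ p ∈ s := fun p => by rw [← h2]; simp
    refine ⟨L ++ [a], ?_, ?_, ?_⟩
    · rw [List.nodup_append']
      refine ⟨h1, by simp, ?_⟩
      intro x hx hx'
      rw [List.mem_singleton] at hx'
      subst hx'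
      exact ha ((hmem x).1 hx)
    · ext x
      simp only [List.mem_toFinset, List.mem_append, hmem, List.mem_singleton, mem_insert]
      tauto
    · rw [List.pairwise_append]
      refine ⟨h3, by simp, ?_⟩
      intro x hx y hy
      rw [List.mem_singleton] at hy
      subst hy
      have hx' := (hmem x).1 hx
      refine lt_of_le_of_ne (hm x hx') ?_
      intro he
      have := hinj x (mem_insert_of_mem hx') y (mem_insert_self _ _) he
      subst this
      exact ha hx'

lemma sorted_nodup {L : List (Finset (Fin n) × (Fin k → ℕ))}
    (h : L.Pairwise (fun p q => bmin p.1 < bmin q.1)) : L.Nodup :=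
  h.imp (fun hab he => by subst he; exact lt_irrefl _ hab)

lemma sorted_unique {L L' : List (Finset (Fin n) × (Fin k → ℕ))}
    (h : L.Pairwise (fun p q => bmin p.1 < bmin q.1))
    (h' : L'.Pairwise (fun p q => bmin p.1 < bmin q.1)) (he : L.toFinset = L'.toFinset) : L = L' :=
  List.Perm.eq_of_pairwise (fun a b _ _ h1 h2 => absurd (h1.trans h2) (lt_irrefl _)) h h'
    (List.perm_of_nodup_nodup_toFinset_eq (sorted_nodup h) (sorted_nodup h') he)

lemma mem_leaves {p : Finset (Fin n) × (Fin k → ℕ)} {T : CTree} (h : T ∈ LTp p) (x : ℕ) :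
    x ∈ T.leavesList ↔ x ∈ lab p.1 := by
  rw [← h.2.1]; simp

lemma cnt_eq {ts : List CTree} (hg : ∀ T ∈ ts, T ∈ LTp (pt n k T))
    (hnd : (ts.map (pt n k)).Nodup) (j : ℕ) :
    cnt ts j = ∑ p ∈ (ts.map (pt n k)).toFinset, ext0 p.2 j := by
  rw [List.sum_toFinset _ hnd, cnt, List.map_map]
  congr 1
  apply List.map_congr_left
  intro T hT
  exact (hg T hT).2.2.2.2 j

lemma isFor_of_sec {B : Finset (Fin n)} {ν : Fin k → ℕ} {α : WP n k} (hα : PartOn B α)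
    (hw : ∀ i, ∑ p ∈ α, p.2 i ≤ ν i) {ts : List CTree} (hg : ∀ T ∈ ts, T ∈ LTp (pt n k T))
    (hs : (ts.map (pt n k)).Pairwise (fun p q => bmin p.1 < bmin q.1))
    (hf : (ts.map (pt n k)).toFinset = α) : IsFor (lab B) ν ts := by
  have hm : ∀ T ∈ ts, pt n k T ∈ α := fun T hT => by
    rw [← hf, List.mem_toFinset]; exact List.mem_map_of_mem hT
  refine ⟨?_, ?_, ?_, ?_, ?_⟩
  · rw [List.pairwise_map] at hs
    refine hs.imp_of_mem ?_
    intro a b ha hb hab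
    rwa [minLeaf_eq (hg a ha), minLeaf_eq (hg b hb)]
  · intro T hT
    exact ⟨(hg T hT).2.2.1, (hg T hT).2.2.2.1⟩
  · rw [lvs, List.nodup_flatMap]
    refine ⟨fun T hT => (hg T hT).1, ?_⟩
    have := sorted_nodup hs
    rw [List.Nodup, List.pairwise_map] at this
    refine this.imp_of_mem ?_
    intro a b ha hb hab x hx hx'
    rw [mem_leaves (hg a ha), mem_lab] at hx
    rw [mem_leaves (hg b hb), mem_lab] at hx'
    obtain ⟨y, hy, h1⟩ := hx
    obtain ⟨z, hz, h2⟩ := hx'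
    have : y = z := Fin.ext (by omega)
    subst this
    exact hab (hα.block_unique (hm a ha) (hm b hb) hy hz)
  · ext x
    simp only [lvs, List.mem_toFinset, List.mem_flatMap]
    constructor
    · rintro ⟨T, hT, hx⟩
      rw [mem_leaves (hg T hT), mem_lab] at hx
      obtain ⟨y, hy, rfl⟩ := hx
      rw [val_mem_lab]
      exact hα.sub (hm T hT) hy
    · intro hx
      rw [mem_lab] at hx
      obtain ⟨y, hy, rfl⟩ := hx
      obtain ⟨p, hp, hyp⟩ := (hα.2.2.1 y).1 hy
      rw [← hf, List.mem_toFinset, List.mem_map] at hp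
      obtain ⟨T, hT, rfl⟩ := hp
      refine ⟨T, hT, ?_⟩
      rwa [mem_leaves (hg T hT), val_mem_lab]
  · intro j
    rw [cnt_eq hg (sorted_nodup hs), hf]
    by_cases hj : j < k
    · have := hw ⟨j, hj⟩
      simpa [ext0, hj] using this
    · simp [ext0, hj]

lemma sec_of_isFor {B : Finset (Fin n)} {ν : Fin k → ℕ} {ts : List CTree}
    (h : IsFor (lab B) ν ts) :
    (∀ T ∈ ts, T ∈ LTp (pt n k T)) ∧
    (ts.map (pt n k)).Pairwise (fun p q => bmin p.1 < bmin q.1) ∧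
    PartOn B (ts.map (pt n k)).toFinset ∧
    ∀ i, ∑ p ∈ (ts.map (pt n k)).toFinset, p.2 i ≤ ν i := by
  have hnd := h.nodup
  rw [lvs, List.nodup_flatMap] at hnd
  have hlab : ∀ x, x ∈ lab B ↔ ∃ T ∈ ts, x ∈ T.leavesList := by
    intro x
    rw [← h.labels]
    simp [lvs]
  have hcc : ∀ T ∈ ts, ∀ j, T.colorCount j ≤ cnt ts j := by
    intro T hT j
    exact List.single_le_sum (fun _ _ => Nat.zero_le _) _ (List.mem_map_of_mem (f := fun T => T.colorCount j) hT)
  have hz : ∀ T ∈ ts, ∀ j, k ≤ j → T.colorCount j = 0 := by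
    intro T hT j hj
    have := hcc T hT j
    rw [h.zero j hj] at this
    omega
  have hg : ∀ T ∈ ts, T ∈ LTp (pt n k T) := by
    intro T hT
    refine ⟨hnd.1 T hT, ?_, (h.good T hT).1, (h.good T hT).2, ?_⟩
    · ext x
      rw [mem_lab, List.mem_toFinset]
      constructor
      · intro hx
        have := (hlab x).2 ⟨T, hT, hx⟩
        rw [mem_lab] at this
        obtain ⟨y, hy, rfl⟩ := this
        exact ⟨y, by simpa [pt] using hx, rfl⟩
      · rintro ⟨y, hy, rfl⟩
        simpa [pt] using hy
    · intro j
      by_cases hj : j < k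
      · simp [ext0, hj, pt]
      · rw [hz T hT j (not_lt.1 hj), ext0_ge _ (not_lt.1 hj)]
  have hs : (ts.map (pt n k)).Pairwise (fun p q => bmin p.1 < bmin q.1) := by
    rw [List.pairwise_map]
    refine h.sorted.imp_of_mem ?_
    intro a b ha hb hab
    rwa [minLeaf_eq (hg a ha), minLeaf_eq (hg b hb)] at hab
  refine ⟨hg, hs, ⟨?_, ?_, ?_, ?_⟩, ?_⟩
  · intro p hp
    rw [List.mem_toFinset, List.mem_map] at hp
    obtain ⟨T, hT, rfl⟩ := hp
    have := minLeaf_mem T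
    rw [mem_leaves (hg T hT), mem_lab] at this
    obtain ⟨y, hy, _⟩ := this
    exact ⟨y, hy⟩
  · intro p hp q hq hne
    rw [List.mem_toFinset, List.mem_map] at hp hq
    obtain ⟨T, hT, rfl⟩ := hp
    obtain ⟨T', hT', rfl⟩ := hq
    have hTT : T ≠ T' := fun he => hne (by rw [he])
    have : Std.Symm (Function.onFun List.Disjoint leavesList) := ⟨fun a b h => List.Disjoint.symm h⟩
    have hd := hnd.2.forall hT hT' hTT
    rw [disjoint_left]
    intro x hx hx'
    simp only [pt, mem_filter] at hx hx'
    exact hd hx.2 hx'.2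
  · intro x
    rw [← val_mem_lab (B := B), hlab]
    constructor
    · rintro ⟨T, hT, hx⟩
      exact ⟨pt n k T, by rw [List.mem_toFinset]; exact List.mem_map_of_mem hT, by simpa [pt] using hx⟩
    · rintro ⟨p, hp, hx⟩
      rw [List.mem_toFinset, List.mem_map] at hp
      obtain ⟨T, hT, rfl⟩ := hp
      exact ⟨T, hT, by simpa [pt] using hx⟩
  · intro p hp
    rw [List.mem_toFinset, List.mem_map] at hp
    obtain ⟨T, hT, rfl⟩ := hp
    have h1 := tree_count (k := k) T (hz T hT)
    rw [← List.toFinset_card_of_nodup (hnd.1 T hT), (hg T hT).2.1, card_lab] at h1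
    rw [← h1, ← sum_ext0]
    congr 1
    exact sum_congr rfl (fun j _ => ((hg T hT).2.2.2.2 j).symm)
  · intro i
    have := h.wt i
    rw [cnt_eq hg (sorted_nodup hs)] at this
    simpa [ext0_val] using this

noncomputable def sgn (p : Finset (Fin n) × (Fin k → ℕ)) : ℤ := (-1) ^ (WP.wsum p.2) * (ell p.2 : ℤ)

open Classical in
lemma block_sum_zero (B : Finset (Fin n)) (ν : Fin k → ℕ) (hν : WP.wsum ν + 1 = B.card)
    (hB : 2 ≤ B.card) :
    ∑ α ∈ (parts k B).filter (fun α => ∀ i, ∑ p ∈ α, p.2 i ≤ ν i), ∏ p ∈ α, sgn p = 0 := by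
  set D := (parts k B).filter (fun α => ∀ i, ∑ p ∈ α, p.2 i ≤ ν i) with hD
  have hmD : ∀ α, α ∈ D ↔ PartOn B α ∧ ∀ i, ∑ p ∈ α, p.2 i ≤ ν i := by
    intro α; rw [hD, mem_filter, mem_parts]
  have hex : ∀ α : WP n k, ∃ L : List (Finset (Fin n) × (Fin k → ℕ)), α ∈ D → (L.Nodup ∧ L.toFinset = α ∧
      L.Pairwise (fun p q => bmin p.1 < bmin q.1)) := by
    intro α
    by_cases h : α ∈ D
    · obtain ⟨L, hL⟩ := exists_sorted ((hmD α).1 h).1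
      exact ⟨L, fun _ => hL⟩
    · exact ⟨[], fun h' => absurd h' h⟩
  choose Ls hLs using hex
  have hF : ∀ ts, ts ∈ D.biUnion (fun α => sec (Ls α)) ↔ IsFor (lab B) ν ts := by
    intro ts
    rw [mem_biUnion]
    constructor
    · rintro ⟨α, hα, hts⟩
      rw [mem_sec] at hts
      obtain ⟨l1, l2, l3⟩ := hLs α hα
      obtain ⟨a1, a2⟩ := (hmD α).1 hα
      exact isFor_of_sec a1 a2 hts.2 (hts.1 ▸ l3) (hts.1 ▸ l2)
    · intro h
      obtain ⟨h1, h2, h3, h4⟩ := sec_of_isFor h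
      have hα := (hmD _).2 ⟨h3, h4⟩
      obtain ⟨l1, l2, l3⟩ := hLs _ hα
      refine ⟨_, hα, ?_⟩
      rw [mem_sec]
      exact ⟨sorted_unique h2 l3 l2.symm, h1⟩
  have hz := forest_sum_zero (A := lab B) (ν := ν) (by rw [card_lab]; exact hν) (by rw [card_lab]; exact hB) _ hF
  rw [sum_biUnion] at hz
  · have key : ∀ α ∈ D, ∏ p ∈ α, sgn p = (-1) ^ B.card * ∑ ts ∈ sec (Ls α), (-1 : ℤ) ^ ts.length := by
      intro α hα
      obtain ⟨l1, l2, l3⟩ := hLs α hα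
      obtain ⟨a1, a2⟩ := (hmD α).1 hα
      have e1 : ∑ ts ∈ sec (Ls α), (-1 : ℤ) ^ ts.length = ∑ ts ∈ sec (Ls α), (-1 : ℤ) ^ α.card := by
        apply sum_congr rfl
        intro ts hts
        rw [mem_sec] at hts
        congr 1
        rw [← l2, List.toFinset_card_of_nodup l1, ← hts.1, List.length_map]
      have e2 : (sec (Ls α)).card = ∏ p ∈ α, ell p.2 := by
        rw [card_sec]
        · conv_rhs => rw [← l2]
          rw [List.prod_toFinset _ l1]
        · intro p hp
          exact a1.2.2.2 p (by rw [← l2, List.mem_toFinset]; exact hp)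
      rw [e1, sum_const, e2, nsmul_eq_mul]
      simp only [sgn]
      rw [prod_mul_distrib, prod_pow_eq_pow_sum, ← a1.sum_wsum]
      push_cast
      rw [pow_add]
      have : ((-1 : ℤ) ^ α.card) * (-1) ^ α.card = 1 := by
        rw [← mul_pow]; simp
      linear_combination (-(-1 : ℤ) ^ (∑ p ∈ α, WP.wsum p.2) * ∏ p ∈ α, (ell p.2 : ℤ)) * this
    rw [sum_congr rfl key, ← mul_sum, hz, mul_zero]
  · intro α hα β hβ hne
    rw [Function.onFun, disjoint_left]
    intro ts h1 h2
    rw [mem_sec] at h1 h2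
    apply hne
    rw [← (hLs α hα).2.1, ← (hLs β hβ).2.1, ← h1.1, ← h2.1]

end WW

namespace WW
open Finset
open CTree

variable {n k : ℕ}

/-- the blocks of `α` contained in `B` -/
def sub (α : WP n k) (B : Finset (Fin n)) : WP n k := α.filter (fun p => p.1 ⊆ B)

lemma mem_sub {α : WP n k} {B : Finset (Fin n)} {p : Finset (Fin n) × (Fin k → ℕ)} :
    p ∈ sub α B ↔ p ∈ α ∧ p.1 ⊆ B := by simp [sub]

lemma sub_partOn {α β : WP n k} (hα : PartOn univ α) (hβ : PartOn univ β)
    (hr : ∀ p ∈ α, ∃ q ∈ β, p.1 ⊆ q.1) {q : Finset (Fin n) × (Fin k → ℕ)} (hq : q ∈ β) :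
    PartOn q.1 (sub α q.1) := by
  have hs : sub α q.1 ⊆ α := fun p hp => (mem_sub.1 hp).1
  have := hα.subset hs
  convert this using 1
  ext x
  rw [mem_biUnion]
  constructor
  · intro hx
    obtain ⟨p, hp, hxp⟩ := (hα.2.2.1 x).1 (mem_univ x)
    obtain ⟨q', hq', hpq⟩ := hr p hp
    have : q' = q := hβ.block_unique hq' hq (hpq hxp) hx
    subst this
    exact ⟨p, mem_sub.2 ⟨hp, hpq⟩, hxp⟩
  · rintro ⟨p, hp, hxp⟩
    exact (mem_sub.1 hp).2 hxp

lemma le_iff (α β : WP n k) : WP.le α β ↔ PartOn univ α ∧ PartOn univ β ∧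
    (∀ p ∈ α, ∃ q ∈ β, p.1 ⊆ q.1) ∧ ∀ q ∈ β, ∀ i, ∑ p ∈ sub α q.1, p.2 i ≤ q.2 i := by
  simp only [WP.le, isWP_iff]
  constructor
  · rintro ⟨h1, h2, h3, h4⟩
    exact ⟨h1, h2, h3, fun q hq => (h4 q hq).1⟩
  · rintro ⟨h1, h2, h3, h4⟩
    refine ⟨h1, h2, h3, fun q hq => ⟨h4 q hq, ?_⟩⟩
    have hp := sub_partOn h1 h2 h3 hq
    have e := hp.sum_wsum
    have e2 := h2.2.2.2 q hq
    have e3 : ∑ i, (q.2 i - ∑ p ∈ sub α q.1, p.2 i) = WP.wsum q.2 - ∑ p ∈ sub α q.1, WP.wsum p.2 := by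
      rw [sum_tsub_distrib _ (fun i _ => h4 q hq i), sum_comm]
      rfl
    change ∑ i, (q.2 i - ∑ p ∈ sub α q.1, p.2 i) = (sub α q.1).card - 1
    rw [e3]
    omega

lemma sub_self {β : WP n k} (hβ : PartOn univ β) {q : Finset (Fin n) × (Fin k → ℕ)} (hq : q ∈ β) :
    sub β q.1 = {q} := by
  ext p
  rw [mem_sub, mem_singleton]
  constructor
  · rintro ⟨hp, hs⟩
    obtain ⟨x, hx⟩ := hβ.1 p hp
    exact hβ.block_unique hp hq hx (hs hx)
  · rintro rfl; exact ⟨hq, Subset.refl _⟩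

lemma le_refl' {β : WP n k} (hβ : PartOn univ β) : WP.le β β := by
  rw [le_iff]
  refine ⟨hβ, hβ, fun p hp => ⟨p, hp, Subset.refl _⟩, fun q hq i => ?_⟩
  rw [sub_self hβ hq, sum_singleton]

lemma bot_partOn : PartOn univ (WP.bot n k) := by
  refine ⟨?_, ?_, ?_, ?_⟩
  · intro p hp
    simp only [WP.bot, mem_image, mem_univ, true_and] at hp
    obtain ⟨x, rfl⟩ := hp
    simp
  · intro p hp q hq hne
    simp only [WP.bot, mem_image, mem_univ, true_and] at hp hq
    obtain ⟨x, rfl⟩ := hp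
    obtain ⟨y, rfl⟩ := hq
    simp only [disjoint_singleton]
    rintro rfl
    exact hne rfl
  · intro x
    simp [WP.bot]
  · intro p hp
    simp only [WP.bot, mem_image, mem_univ, true_and] at hp
    obtain ⟨x, rfl⟩ := hp
    simp [WP.wsum]

lemma bot_le {β : WP n k} (hβ : PartOn univ β) : WP.le (WP.bot n k) β := by
  rw [le_iff]
  refine ⟨bot_partOn, hβ, ?_, ?_⟩
  · intro p hp
    simp only [WP.bot, mem_image, mem_univ, true_and] at hp
    obtain ⟨x, rfl⟩ := hp
    obtain ⟨q, hq, hx⟩ := (hβ.2.2.1 x).1 (mem_univ x)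
    exact ⟨q, hq, by simpa using hx⟩
  · intro q hq i
    rw [sum_eq_zero]
    · exact Nat.zero_le _
    · intro p hp
      rw [mem_sub] at hp
      have hp := hp.1
      simp only [WP.bot, mem_image, mem_univ, true_and] at hp
      obtain ⟨x, rfl⟩ := hp
      rfl

lemma eq_bot {β : WP n k} (hβ : PartOn univ β) (h : ∀ q ∈ β, q.1.card < 2) : β = WP.bot n k := by
  have key : ∀ q ∈ β, ∃ x, q = ({x}, fun _ => 0) := by
    intro q hq
    have h1 := hβ.2.2.2 q hq
    have h2 := h q hq
    have h3 : WP.wsum q.2 = 0 := by omega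
    obtain ⟨x, hx⟩ := card_eq_one.1 (show q.1.card = 1 by omega)
    refine ⟨x, Prod.ext hx ?_⟩
    funext i
    rw [WP.wsum, sum_eq_zero_iff] at h3
    exact h3 i (mem_univ i)
  ext p
  simp only [WP.bot, mem_image, mem_univ, true_and]
  constructor
  · intro hp
    obtain ⟨x, hx⟩ := key p hp
    exact ⟨x, hx.symm⟩
  · rintro ⟨x, rfl⟩
    obtain ⟨q, hq, hxq⟩ := (hβ.2.2.1 x).1 (mem_univ x)
    obtain ⟨y, rfl⟩ := key q hq
    simp only [mem_singleton] at hxq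
    subst hxq
    exact hq

lemma card_lt {α β : WP n k} (h : WP.le α β) (hne : α ≠ β) : β.card < α.card := by
  rw [le_iff] at h
  obtain ⟨h1, h2, h3, h4⟩ := h
  by_contra hlt
  rw [not_lt] at hlt
  have e : α = β.biUnion (fun q => sub α q.1) := by
    ext p
    simp only [mem_biUnion, mem_sub]
    constructor
    · intro hp
      obtain ⟨q, hq, hs⟩ := h3 p hp
      exact ⟨q, hq, hp, hs⟩
    · rintro ⟨q, hq, hp, hs⟩
      exact hp
  have hc : α.card = ∑ q ∈ β, (sub α q.1).card := by
    conv_lhs => rw [e]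
    apply card_biUnion
    intro q hq q' hq' hqq
    change Disjoint (sub α q.1) (sub α q'.1)
    rw [disjoint_left]
    intro p hp hp'
    rw [mem_sub] at hp hp'
    obtain ⟨x, hx⟩ := h1.1 p hp.1
    exact hqq (h2.block_unique hq hq' (hp.2 hx) (hp'.2 hx))
  have hpos : ∀ q ∈ β, 1 ≤ (sub α q.1).card := by
    intro q hq
    have hp := sub_partOn h1 h2 h3 hq
    obtain ⟨x, hx⟩ := h2.1 q hq
    obtain ⟨p, hp', _⟩ := (hp.2.2.1 x).1 hx
    exact card_pos.2 ⟨p, hp'⟩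
  have hone : ∀ q ∈ β, 1 = (sub α q.1).card := by
    rw [← sum_eq_sum_iff_of_le hpos]
    apply le_antisymm (sum_le_sum hpos)
    rw [← hc, sum_const]; simpa using hlt
  have hsub : β ⊆ α := by
    intro q hq
    have hp := sub_partOn h1 h2 h3 hq
    obtain ⟨p, hpe⟩ := card_eq_one.1 (hone q hq).symm
    have h5 := h4 q hq
    rw [hpe] at hp h5
    have hpα : p ∈ α := (mem_sub.1 (hpe ▸ mem_singleton_self p : p ∈ sub α q.1)).1
    have e1 : p.1 = q.1 := by
      ext x
      rw [hp.2.2.1 x]; simp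
    have e2 : p.2 = q.2 := by
      have w1 := h2.2.2.2 q hq
      have w2 := h1.2.2.2 p hpα
      rw [e1] at w2
      have w3 : WP.wsum p.2 = WP.wsum q.2 := by omega
      have w4 := (sum_eq_sum_iff_of_le (s := univ) (f := p.2) (g := q.2) (fun i _ => by simpa using h5 i)).1 w3
      funext i
      exact w4 i (mem_univ i)
    have : p = q := Prod.ext e1 e2
    exact this ▸ hpα
  exact hne (eq_of_subset_of_card_le hsub hlt).symm

lemma ell_zero : ell (fun _ : Fin k => 0) = 1 := by
  have : LynSetF (WP.wsum (fun _ : Fin k => 0) + 1) k (fun _ => 0) = {CTree.leaf 1} := by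
    ext T
    simp only [LynSetF, WP.wsum, sum_const_zero, zero_add, OnSet, Set.mem_ofPred_eq, Set.mem_singleton_iff]
    constructor
    · rintro ⟨h, _⟩
      cases T with
      | leaf a =>
        have := h.mem_iff (a := a)
        simp [leavesList] at this
        rw [this]
      | node c l r =>
        have h1 := h.length_eq
        have h2 := List.length_pos_of_mem (minLeaf_mem l)
        have h3 := List.length_pos_of_mem (minLeaf_mem r)
        simp [leavesList] at h1
        omega
    · rintro rfl
      refine ⟨by simp [leavesList], trivial, trivial, ?_⟩
      intro j; simp [colorCount]
  rw [ell, this]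
  simp

lemma prod_bot : ∏ p ∈ WP.bot n k, sgn p = 1 := by
  apply prod_eq_one
  intro p hp
  simp only [WP.bot, mem_image, mem_univ, true_and] at hp
  obtain ⟨x, rfl⟩ := hp
  simp [sgn, ell_zero, WP.wsum]

open Classical in
lemma interval_sum_zero {β : WP n k} (hβ : PartOn univ β) (hne : β ≠ WP.bot n k) :
    ∑ α ∈ (parts k univ).filter (fun α => WP.le α β), ∏ p ∈ α, sgn p = 0 := by
  obtain ⟨q, hq, hqc⟩ : ∃ q ∈ β, 2 ≤ q.1.card := by
    by_contra hcon
    push Not at hcon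
    exact hne (eq_bot hβ hcon)
  set D := (parts k univ).filter (fun α => WP.le α β) with hD
  have hmD : ∀ α, α ∈ D ↔ WP.le α β := by
    intro α
    rw [hD, mem_filter, mem_parts]
    constructor
    · exact fun h => h.2
    · exact fun h => ⟨((le_iff _ _).1 h).1, h⟩
  rw [← sum_fiberwise_of_maps_to (t := D.image (fun α => α.filter (fun p => ¬ p.1 ⊆ q.1)))
    (g := fun α => α.filter (fun p => ¬ p.1 ⊆ q.1)) (fun α hα => mem_image_of_mem _ hα)]
  apply sum_eq_zero
  intro γ hγ
  rw [mem_image] at hγ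
  obtain ⟨α0, hα0, hγ⟩ := hγ
  rw [hmD, le_iff] at hα0
  obtain ⟨a1, -, a3, a4⟩ := hα0
  have hmγ : ∀ p, p ∈ γ ↔ p ∈ α0 ∧ ¬ p.1 ⊆ q.1 := by
    intro p; rw [← hγ, mem_filter]
  have hγq : ∀ p ∈ γ, Disjoint p.1 q.1 := by
    intro p hp
    rw [hmγ] at hp
    obtain ⟨q', hq', hs⟩ := a3 p hp.1
    refine disjoint_of_subset_left hs (hβ.2.1 q' hq' q hq ?_)
    rintro rfl
    exact hp.2 hs
  have hγpart : PartOn (univ \ q.1) γ := by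
    have hsub : γ ⊆ α0 := fun p hp => ((hmγ p).1 hp).1
    convert a1.subset hsub using 1
    ext x
    simp only [mem_sdiff, mem_univ, true_and, mem_biUnion]
    constructor
    · intro hx
      obtain ⟨p, hp, hxp⟩ := (a1.2.2.1 x).1 (mem_univ x)
      exact ⟨p, (hmγ p).2 ⟨hp, fun h => hx (h hxp)⟩, hxp⟩
    · rintro ⟨p, hp, hxp⟩ hx
      exact disjoint_left.1 (hγq p hp) hxp hx
  have hz := block_sum_zero q.1 q.2 (hβ.2.2.2 q hq) hqc
  -- facts on unions
  have hsubq : ∀ α' : WP n k, PartOn q.1 α' → sub (α' ∪ γ) q.1 = α' := by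
    intro α' hα'
    ext p
    rw [mem_sub, mem_union]
    constructor
    · rintro ⟨hp | hp, hs⟩
      · exact hp
      · exact absurd hs ((hmγ p).1 hp).2
    · intro hp
      exact ⟨Or.inl hp, hα'.sub hp⟩
  have hdisj : ∀ α' : WP n k, PartOn q.1 α' → Disjoint α' γ := by
    intro α' hα'
    rw [disjoint_left]
    intro p hp hp'
    exact ((hmγ p).1 hp').2 (hα'.sub hp)
  have hsum : ∑ α ∈ D.filter (fun α => α.filter (fun p => ¬ p.1 ⊆ q.1) = γ), ∏ p ∈ α, sgn p =
      ∑ α' ∈ (parts k q.1).filter (fun α => ∀ i, ∑ p ∈ α, p.2 i ≤ q.2 i),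
        (∏ p ∈ α', sgn p) * ∏ p ∈ γ, sgn p := by
    symm
    refine sum_bij (fun α' _ => α' ∪ γ) ?_ ?_ ?_ ?_
    · intro α' hα'
      rw [mem_filter, mem_parts] at hα'
      obtain ⟨b1, b2⟩ := hα'
      rw [mem_filter, hmD, le_iff]
      refine ⟨⟨?_, hβ, ?_, ?_⟩, ?_⟩
      · have := b1.union hγpart (disjoint_sdiff)
        rwa [union_sdiff_of_subset (subset_univ _)] at this
      · intro p hp
        rcases mem_union.1 hp with hp | hp
        · exact ⟨q, hq, b1.sub hp⟩
        · exact a3 p ((hmγ p).1 hp).1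
      · intro q' hq' i
        by_cases hqq : q' = q
        · subst hqq
          rw [hsubq α' b1]
          exact b2 i
        · have hd := hβ.2.1 q' hq' q hq hqq
          have e : sub (α' ∪ γ) q'.1 = sub α0 q'.1 := by
            ext p
            rw [mem_sub, mem_sub, mem_union]
            constructor
            · rintro ⟨hp | hp, hs⟩
              · obtain ⟨x, hx⟩ := b1.1 p hp
                exact absurd (b1.sub hp hx) (disjoint_left.1 hd (hs hx))
              · exact ⟨((hmγ p).1 hp).1, hs⟩
            · rintro ⟨hp, hs⟩
              refine ⟨Or.inr ((hmγ p).2 ⟨hp, fun h => ?_⟩), hs⟩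
              obtain ⟨x, hx⟩ := a1.1 p hp
              exact disjoint_left.1 hd (hs hx) (h hx)
          rw [e]
          exact a4 q' hq' i
      · ext p
        rw [mem_filter, mem_union]
        constructor
        · rintro ⟨hp | hp, hs⟩
          · exact absurd (b1.sub hp) hs
          · exact hp
        · intro hp
          exact ⟨Or.inr hp, ((hmγ p).1 hp).2⟩
    · intro α' h' α'' h'' he
      rw [mem_filter, mem_parts] at h' h''
      rw [← hsubq α' h'.1, he, hsubq α'' h''.1]
    · intro α hα
      rw [mem_filter, hmD, le_iff] at hα
      obtain ⟨⟨b1, -, b3, b4⟩, b5⟩ := hα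
      refine ⟨sub α q.1, ?_, ?_⟩
      · rw [mem_filter, mem_parts]
        exact ⟨sub_partOn b1 hβ b3 hq, b4 q hq⟩
      · rw [← b5]
        exact filter_union_filter_not_eq _ _
    · intro α' hα'
      rw [mem_filter, mem_parts] at hα'
      rw [prod_union (hdisj α' hα'.1)]
  rw [hsum, ← sum_mul]
  convert zero_mul (∏ p ∈ γ, sgn p)

lemma mobiusAux_eq (m : ℕ) : ∀ β : WP n k, PartOn univ β → n ≤ β.card + m →
    WP.mobiusAux WP.le m (WP.bot n k) β = ∏ p ∈ β, sgn p := by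
  classical
  induction m with
  | zero =>
    intro β hβ hc
    have h0 := hβ.sum_wsum
    rw [card_univ, Fintype.card_fin] at h0
    have h1 : ∑ p ∈ β, WP.wsum p.2 = 0 := by omega
    rw [sum_eq_zero_iff] at h1
    have : β = WP.bot n k := eq_bot hβ (fun q hq => by
      have := hβ.2.2.2 q hq
      rw [h1 q hq] at this; omega)
    subst this
    rw [prod_bot]
    simp [WP.mobiusAux]
  | succ m ih =>
    intro β hβ hc
    by_cases hb : WP.bot n k = β
    · subst hb
      rw [prod_bot]
      simp [WP.mobiusAux]
    · rw [WP.mobiusAux, if_neg hb]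
      have hset : {c | WP.le (WP.bot n k) c ∧ WP.le c β ∧ c ≠ β} =
          ((((parts k univ).filter (fun α => WP.le α β)).erase β : Finset (WP n k)) : Set (WP n k)) := by
        ext c
        simp only [Set.mem_ofPred_eq, coe_erase, Set.mem_sdiff, mem_coe, mem_filter, mem_parts, Set.mem_singleton_iff]
        constructor
        · rintro ⟨h1, h2, h3⟩
          exact ⟨⟨((le_iff _ _).1 h2).1, h2⟩, h3⟩
        · rintro ⟨⟨h1, h2⟩, h3⟩
          exact ⟨bot_le h1, h2, h3⟩
      rw [hset, finsum_mem_coe_finset]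
      have hz := interval_sum_zero hβ (fun h => hb h.symm)
      have hmem : β ∈ (parts k univ).filter (fun α => WP.le α β) := by
        rw [mem_filter, mem_parts]; exact ⟨hβ, le_refl' hβ⟩
      have hz' : ∑ α ∈ (parts k univ).filter (fun α => WP.le α β), ∏ p ∈ α, sgn p = 0 := by
        convert hz
      rw [← add_sum_erase _ _ hmem] at hz'
      have : ∑ c ∈ ((parts k univ).filter (fun α => WP.le α β)).erase β,
          WP.mobiusAux WP.le m (WP.bot n k) c =
          ∑ c ∈ ((parts k univ).filter (fun α => WP.le α β)).erase β, ∏ p ∈ c, sgn p := by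
        apply sum_congr rfl
        intro c hcc
        rw [mem_erase, mem_filter, mem_parts] at hcc
        have := card_lt hcc.2.2 hcc.1
        exact ih c hcc.2.1 (by omega)
      rw [this]
      omega

lemma mobius_eq {β : WP n k} (hβ : PartOn univ β) :
    WP.mobius (WP.bot n k) β = ∏ p ∈ β, sgn p :=
  mobiusAux_eq n β hβ (by omega)

lemma xmon_eq (α : WP n k) :
    xmon α = ∏ p ∈ α, ∏ i, (MvPolynomial.X i : MvPolynomial (Fin k) ℚ) ^ p.2 i := by
  rw [xmon, prod_comm]
  exact prod_congr rfl (fun i _ => (prod_pow_eq_pow_sum _ _ _).symm)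

lemma wp_set (m : ℕ) : {α : WP n k | WP.IsWP α ∧ α.card = m} =
    (((parts k (univ : Finset (Fin n))).filter (fun α => α.card = m) : Finset (WP n k)) : Set (WP n k)) := by
  ext α
  simp [mem_parts, isWP_iff]

lemma par_set (r : ℕ) : ParSet n r = ((ParF n (n - r) : Finset (Multiset ℕ)) : Set (Multiset ℕ)) := by
  ext l
  simp [mem_ParF, ParSet]

end WW

open MvPolynomial

/-- The weighted Whitney numbers of the first and second kind of `Π_n^k` with
respect to the weighting `ϖ(0̂,α) = x^{μ(α)}`:
`w_r = Σ_{ρ(α) = r} μ̄(0̂,α)·x^{μ(α)} = (-1)^r Σ_{λ ⊢ n, ℓ(λ) = n-r} (n choose λ)(1/m(λ)!) L_{λ∖(1^{n-r})}`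
and
`W_r = Σ_{ρ(α) = r} x^{μ(α)} = Σ_{λ ⊢ n, ℓ(λ) = n-r} (n choose λ)(1/m(λ)!) h_{λ∖(1^{n-r})}`.
(The rank of `α ∈ Π_n^k` is `ρ(α) = n - |α|`.) -/
theorem weighted_whitney_numbers (n k r : ℕ) (hn : 1 ≤ n) (hk : 1 ≤ k) (hr : r ≤ n - 1) :
    (∑ᶠ α ∈ {α : WP n k | WP.IsWP α ∧ α.card = n - r},
        (WP.mobius (WP.bot n k) α : MvPolynomial (Fin k) ℚ) * xmon α) =
      (-1 : MvPolynomial (Fin k) ℚ) ^ r *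
        ∑ᶠ lam ∈ ParSet n r, qcoef n lam • LprodShift k lam ∧
    (∑ᶠ α ∈ {α : WP n k | WP.IsWP α ∧ α.card = n - r}, xmon α) =
      ∑ᶠ lam ∈ ParSet n r, qcoef n lam • hprodShift k lam := by
  rw [WW.wp_set, WW.par_set]
  simp only [finsum_mem_coe_finset]
  constructor
  · have hL : ∀ t, ∑ g ∈ Finset.Nat.antidiagonalTuple k t,
        ((WW.ell g : MvPolynomial (Fin k) ℚ) * ∏ i, X i ^ g i) = Lpoly k t := by
      intro t
      rw [Lpoly]
      apply Finset.sum_congr rfl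
      intro g hg
      rw [Finset.Nat.mem_antidiagonalTuple] at hg
      rw [WW.ell, WP.wsum, hg]
    have h := WW.Q_eq_P (R := MvPolynomial (Fin k) ℚ)
      (fun g => (WW.ell g : MvPolynomial (Fin k) ℚ) * ∏ i, X i ^ g i) (n - r) (Finset.univ : Finset (Fin n))
    simp only [hL, Finset.card_univ, Fintype.card_fin, WW.P] at h
    simp only [LprodShift]
    rw [← h, Finset.mul_sum]
    apply Finset.sum_congr rfl
    intro α hα
    rw [Finset.mem_filter, WW.mem_parts] at hα
    have hs := hα.1.sum_wsum
    rw [Finset.card_univ, Fintype.card_fin, hα.2] at hs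
    have hs' : ∑ p ∈ α, WP.wsum p.2 = r := by omega
    rw [WW.mobius_eq hα.1, WW.xmon_eq, Finset.prod_mul_distrib, ← mul_assoc]
    congr 1
    simp only [WW.sgn]
    rw [Finset.prod_mul_distrib, Finset.prod_pow_eq_pow_sum, hs']
    push_cast
    rfl
  · have h := WW.Q_eq_P (R := MvPolynomial (Fin k) ℚ)
      (fun g => ∏ i, X i ^ g i) (n - r) (Finset.univ : Finset (Fin n))
    simp only [Finset.card_univ, Fintype.card_fin, WW.P] at h
    simp only [hprodShift, hpoly, WW.xmon_eq]
    exact h
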